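/- arXiv:2308.04339 — 8 statements merged into one kernel-verified Lean document; each statement's English description precedes it below -/
import Mathlib

section
/- The adjacency operator A_R of the infinite ray has no eigenvalues: there is no scalar λ and no nonzero ξ ∈ ℓ²(ℕ, ℂ) with A_R ξ = λ ξ. -/
noncomputable section

open Filter Topology in
/-- The coordinates of a square-summable sequence tend to zero. -/
theorem lp_two_tendsto_zero (ξ : lp (fun _ : ℕ => ℂ) 2) :
    Tendsto (fun n => ξ n) atTop (𝓝 0) := by
  have h := ((lp.memℓp ξ).summable (by norm_num)).tendsto_atTop_zero
  rw [tendsto_zero_iff_norm_tendsto_zero]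
  have h2 := h.sqrt
  simpa [Real.sqrt_sq] using h2

/-- A solution of the free Jacobi recurrence conserves the quadratic form
`x ^ 2 - lam * x * y + y ^ 2` of consecutive terms. -/
theorem jacobi_recurrence_invariant {u : ℕ → ℂ} {lam : ℂ} (h0 : u 1 = lam * u 0)
    (h : ∀ n, u n + u (n + 2) = lam * u (n + 1)) (n : ℕ) :
    u n ^ 2 - lam * u n * u (n + 1) + u (n + 1) ^ 2 = u 0 ^ 2 := by
  induction n with
  | zero => rw [zero_add, h0]; ring
  | succ k ih =>
    rw [← ih, eq_sub_of_add_eq' (h k)]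
    ring

open Filter Topology in
/-- A solution of the free Jacobi recurrence that tends to zero vanishes identically. -/
theorem jacobi_recurrence_eq_zero {u : ℕ → ℂ} {lam : ℂ} (h0 : u 1 = lam * u 0)
    (h : ∀ n, u n + u (n + 2) = lam * u (n + 1)) (hu : Tendsto u atTop (𝓝 0)) (n : ℕ) :
    u n = 0 := by
  have hu' := hu.comp (tendsto_add_atTop_nat 1)
  have hlim := ((hu.pow 2).sub ((hu.const_mul lam).mul hu')).add (hu'.pow 2)
  have hconst : Tendsto (fun _ : ℕ => u 0 ^ 2) atTop (𝓝 0) := by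
    simpa [Function.comp_def, jacobi_recurrence_invariant h0 h] using hlim
  have hz : u 0 = 0 := by simpa using tendsto_nhds_unique tendsto_const_nhds hconst
  induction n using Nat.twoStepInduction with
  | zero => exact hz
  | one => rw [h0, hz, mul_zero]
  | more k ih₀ ih₁ => simpa [ih₀, ih₁] using h k

/-- The adjacency operator of the infinite ray has no eigenvalues. -/
theorem stmt_1
    (A : lp (fun _ : ℕ => ℂ) 2 →L[ℂ] lp (fun _ : ℕ => ℂ) 2)
    (hA : ∀ (ξ : lp (fun _ : ℕ => ℂ) 2) (n : ℕ),
      A ξ n = (if n = 0 then 0 else ξ (n - 1)) + ξ (n + 1)) :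
    ¬ ∃ (lam : ℂ) (ξ : lp (fun _ : ℕ => ℂ) 2), ξ ≠ 0 ∧ A ξ = lam • ξ := by
  rintro ⟨lam, ξ, hξ, hev⟩
  have hrec (n : ℕ) : (if n = 0 then 0 else ξ (n - 1)) + ξ (n + 1) = lam * ξ n := by
    rw [← hA, hev, lp.coeFn_smul, Pi.smul_apply, smul_eq_mul]
  refine hξ (lp.ext (funext fun n => ?_))
  exact jacobi_recurrence_eq_zero (u := fun n => ξ n) (by simpa using hrec 0)
    (fun n => by simpa using hrec (n + 1)) (lp_two_tendsto_zero ξ) n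
end
end

section
/- The adjacency operator A_R of the infinite ray is unitarily equivalent to the operator of multiplication by the identity function x ↦ x on the Hilbert space L²(ℝ, μ), where μ is the semicircle measure. -/
noncomputable section

open MeasureTheory

/-- The semicircle measure on `ℝ`: density `(1/(2π))·√(4 - x²)` on `[-2, 2]` with respect to
Lebesgue measure. -/
def semicircleMeasure : Measure ℝ :=
  volume.withDensity fun x =>
    ENNReal.ofReal
      (Set.indicator (Set.Icc (-2 : ℝ) 2) (fun x => 1 / (2 * Real.pi) * Real.sqrt (4 - x ^ 2)) x)

open Polynomial Polynomial.Chebyshev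

/-- The Chebyshev polynomials `S n`, `n ≥ 0`, span the space of all polynomials. -/
theorem span_range_chebyshevS_eq_top :
    Submodule.span ℝ (Set.range fun n : ℕ => S ℝ n) = ⊤ := by
  set W := Submodule.span ℝ (Set.range fun n : ℕ => S ℝ n)
  have hX : ∀ p ∈ W, X * p ∈ W := by
    intro p hp
    induction hp using Submodule.span_induction with
    | mem p hp =>
      obtain ⟨n, rfl⟩ := hp
      have hsucc : S ℝ (n + 1 : ℕ) ∈ W := Submodule.subset_span ⟨n + 1, rfl⟩
      have hpred : S ℝ ((n : ℤ) - 1) ∈ W := by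
        cases n with
        | zero => simp
        | succ m => exact Submodule.subset_span ⟨m, by simp⟩
      have h := S_add_one ℝ n
      have : X * S ℝ n = S ℝ (n + 1 : ℕ) + S ℝ ((n : ℤ) - 1) := by
        push_cast
        rw [h]
        ring
      exact this ▸ W.add_mem hsucc hpred
    | zero => simp
    | add p q _ _ hp hq => rw [mul_add]; exact W.add_mem hp hq
    | smul a p _ hp => rw [mul_smul_comm]; exact W.smul_mem a hp
  have hpow : ∀ k : ℕ, (X ^ k : ℝ[X]) ∈ W := by
    intro k
    induction k with
    | zero => exact Submodule.subset_span ⟨0, by simp⟩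
    | succ k ih => rw [pow_succ']; exact hX _ ih
  refine Submodule.eq_top_iff'.2 fun p => ?_
  induction p using Polynomial.induction_on' with
  | add p q hp hq => exact W.add_mem hp hq
  | monomial n a =>
    rw [← C_mul_X_pow_eq_monomial, ← smul_eq_C_mul]
    exact W.smul_mem a (hpow n)

theorem integrable_semicircle_density :
    Integrable (Set.indicator (Set.Icc (-2 : ℝ) 2)
      (fun x => 1 / (2 * Real.pi) * Real.sqrt (4 - x ^ 2))) := by
  rw [integrable_indicator_iff measurableSet_Icc]
  exact (Continuous.continuousOn (by fun_prop)).integrableOn_Icc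

theorem semicircle_density_nonneg (x : ℝ) :
    0 ≤ Set.indicator (Set.Icc (-2 : ℝ) 2)
      (fun x => 1 / (2 * Real.pi) * Real.sqrt (4 - x ^ 2)) x :=
  Set.indicator_nonneg (fun _ _ => by positivity) x

instance isFiniteMeasure_semicircleMeasure :
    IsFiniteMeasure semicircleMeasure :=
  isFiniteMeasure_withDensity_ofReal integrable_semicircle_density.2

theorem ae_semicircleMeasure_mem_Icc : ∀ᵐ x ∂semicircleMeasure, x ∈ Set.Icc (-2 : ℝ) 2 := by
  have hm : Measurable fun x => ENNReal.ofReal (Set.indicator (Set.Icc (-2 : ℝ) 2)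
      (fun x => 1 / (2 * Real.pi) * Real.sqrt (4 - x ^ 2)) x) :=
    (Measurable.indicator (by fun_prop) measurableSet_Icc).ennreal_ofReal
  rw [semicircleMeasure, ae_withDensity_iff hm]
  refine Filter.Eventually.of_forall fun x hx => ?_
  by_contra h
  simp [Set.indicator_of_notMem h] at hx

theorem integral_semicircleMeasure (f : ℝ → ℝ) :
    ∫ x, f x ∂semicircleMeasure =
      ∫ x in (-2)..2, 1 / (2 * Real.pi) * Real.sqrt (4 - x ^ 2) * f x := by
  have hm : Measurable (Set.indicator (Set.Icc (-2 : ℝ) 2)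
      (fun x => 1 / (2 * Real.pi) * Real.sqrt (4 - x ^ 2))) :=
    Measurable.indicator (by fun_prop) measurableSet_Icc
  rw [semicircleMeasure, integral_withDensity_eq_integral_toReal_smul hm.ennreal_ofReal
    (by simp), intervalIntegral.integral_of_le (by norm_num), ← integral_Icc_eq_integral_Ioc,
    ← integral_indicator measurableSet_Icc]
  congr 1 with x
  rw [ENNReal.toReal_ofReal (semicircle_density_nonneg x)]
  by_cases hx : x ∈ Set.Icc (-2 : ℝ) 2 <;> simp [hx]

theorem integral_semicircleMeasure_eq_integral_cos {f : ℝ → ℝ} (hf : Continuous f) :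
    ∫ x, f x ∂semicircleMeasure =
      ∫ θ in 0..Real.pi, 2 / Real.pi * Real.sin θ ^ 2 * f (2 * Real.cos θ) := by
  have h := intervalIntegral.integral_comp_mul_deriv (a := 0) (b := Real.pi)
    (f := fun θ => 2 * Real.cos θ) (f' := fun θ => 2 * -Real.sin θ)
    (g := fun x => 1 / (2 * Real.pi) * Real.sqrt (4 - x ^ 2) * f x)
    (fun θ _ => (Real.hasDerivAt_cos θ).const_mul 2) (by fun_prop) (by fun_prop)
  simp only [Real.cos_zero, Real.cos_pi, mul_neg, mul_one] at h
  rw [integral_semicircleMeasure, intervalIntegral.integral_symm, ← h,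
    ← intervalIntegral.integral_neg]
  refine intervalIntegral.integral_congr fun θ hθ => ?_
  rw [Set.uIcc_of_le Real.pi_nonneg] at hθ
  have hsin := Real.sin_nonneg_of_mem_Icc hθ
  have hsqrt : Real.sqrt (4 - (2 * Real.cos θ) ^ 2) = 2 * Real.sin θ := by
    rw [← Real.sqrt_sq (by positivity : 0 ≤ 2 * Real.sin θ)]
    congr 1
    nlinarith [Real.sin_sq_add_cos_sq θ]
  simp only [Function.comp_apply, hsqrt]
  field_simp

theorem integral_cos_int_mul {k : ℤ} (hk : k ≠ 0) :
    ∫ θ in 0..Real.pi, Real.cos (k * θ) = 0 := by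
  rw [intervalIntegral.integral_comp_mul_left _ (Int.cast_ne_zero.mpr hk), integral_cos]
  simp [Real.sin_int_mul_pi]

/-- The Chebyshev polynomials `S n` are orthonormal for the semicircle measure. -/
theorem integral_chebyshevS_mul_chebyshevS (m n : ℕ) :
    ∫ x, (S ℝ m).eval x * (S ℝ n).eval x ∂semicircleMeasure = if m = n then 1 else 0 := by
  rw [integral_semicircleMeasure_eq_integral_cos (by fun_prop)]
  have h (θ : ℝ) : 2 / Real.pi * Real.sin θ ^ 2 *
      ((S ℝ m).eval (2 * Real.cos θ) * (S ℝ n).eval (2 * Real.cos θ)) =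
      1 / Real.pi * (Real.cos ((m - n : ℤ) * θ) - Real.cos ((m + n + 2 : ℤ) * θ)) := by
    have hm := S_two_mul_real_cos θ m
    have hn := S_two_mul_real_cos θ n
    have hc : Real.cos ((m - n : ℤ) * θ) - Real.cos ((m + n + 2 : ℤ) * θ) =
        2 * (Real.sin (((m : ℤ) + 1) * θ) * Real.sin (((n : ℤ) + 1) * θ)) := by
      have h₁ : ((m - n : ℤ) : ℝ) * θ = ((m : ℤ) + 1) * θ - ((n : ℤ) + 1) * θ := by
        push_cast; ring
      have h₂ : ((m + n + 2 : ℤ) : ℝ) * θ = ((m : ℤ) + 1) * θ + ((n : ℤ) + 1) * θ := by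
        push_cast; ring
      rw [h₁, h₂, Real.cos_sub, Real.cos_add]
      ring
    rw [hc, ← hm, ← hn]
    ring
  simp_rw [h]
  rw [intervalIntegral.integral_const_mul, intervalIntegral.integral_sub
    (Continuous.intervalIntegrable (by fun_prop) _ _)
    (Continuous.intervalIntegrable (by fun_prop) _ _),
    integral_cos_int_mul (k := m + n + 2) (by positivity)]
  split_ifs with hmn
  · subst hmn
    simp [Real.pi_ne_zero]
  · rw [integral_cos_int_mul (by omega)]
    simp

theorem memLp_ofReal_semicircleMeasure {g : ℝ → ℝ} (hg : Continuous g) (p : ENNReal) :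
    MemLp (fun x => (g x : ℂ)) p semicircleMeasure := by
  obtain ⟨c, hc⟩ :=
    isCompact_Icc.exists_bound_of_continuousOn (hg.continuousOn (s := Set.Icc (-2) 2))
  refine MemLp.of_bound (by fun_prop) c ?_
  filter_upwards [ae_semicircleMeasure_mem_Icc] with x hx
  simpa using hc x hx

/-- The class in `L²` of the Chebyshev polynomial `S n`. -/
def chebyshevSLp (n : ℕ) : Lp ℂ 2 semicircleMeasure :=
  (memLp_ofReal_semicircleMeasure (S ℝ n).continuous 2).toLp _

theorem coeFn_chebyshevSLp (n : ℕ) :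
    (chebyshevSLp n : ℝ → ℂ) =ᵐ[semicircleMeasure] fun x => (((S ℝ n).eval x : ℝ) : ℂ) :=
  MemLp.coeFn_toLp _

theorem inner_chebyshevSLp (n : ℕ) (f : Lp ℂ 2 semicircleMeasure) :
    inner ℂ (chebyshevSLp n) f = ∫ x, (S ℝ n).eval x • f x ∂semicircleMeasure := by
  rw [L2.inner_def]
  refine integral_congr_ae ?_
  filter_upwards [coeFn_chebyshevSLp n] with x hx
  rw [hx, RCLike.inner_apply, Complex.conj_ofReal, Complex.real_smul, mul_comm]

theorem orthonormal_chebyshevSLp : Orthonormal ℂ chebyshevSLp := by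
  rw [orthonormal_iff_ite]
  intro m n
  rw [inner_chebyshevSLp]
  have : ∫ x, (S ℝ m).eval x • chebyshevSLp n x ∂semicircleMeasure =
      ∫ x, (((S ℝ m).eval x * (S ℝ n).eval x : ℝ) : ℂ) ∂semicircleMeasure := by
    refine integral_congr_ae ?_
    filter_upwards [coeFn_chebyshevSLp n] with x hx
    rw [hx]
    simp
  rw [this, integral_complex_ofReal, integral_chebyshevS_mul_chebyshevS]
  split_ifs <;> simp

theorem integrable_smul_of_continuous {g : ℝ → ℝ} (hg : Continuous g) {f : ℝ → ℂ}
    (hf : Integrable f semicircleMeasure) :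
    Integrable (fun x => g x • f x) semicircleMeasure := by
  obtain ⟨c, hc⟩ :=
    isCompact_Icc.exists_bound_of_continuousOn (hg.continuousOn (s := Set.Icc (-2) 2))
  refine (hf.norm.const_mul c).mono' (hg.aestronglyMeasurable.smul hf.1) ?_
  filter_upwards [ae_semicircleMeasure_mem_Icc] with x hx
  rw [norm_smul]
  exact mul_le_mul_of_nonneg_right (hc x hx) (norm_nonneg _)

/-- An integrable function all of whose moments with respect to the semicircle measure vanish is
zero almost everywhere. -/
theorem ae_eq_zero_of_integral_polynomial_smul_eq_zero {f : ℝ → ℂ}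
    (hf : Integrable f semicircleMeasure)
    (h : ∀ p : ℝ[X], ∫ x, p.eval x • f x ∂semicircleMeasure = 0) :
    f =ᵐ[semicircleMeasure] 0 := by
  refine ae_eq_zero_of_integral_contDiff_smul_eq_zero hf.locallyIntegrable fun g hg _ => ?_
  have hgc : Continuous g := hg.continuous
  refine norm_le_zero_iff.1 (le_of_forall_pos_le_add fun ε hε => ?_)
  set K := ∫ x, ‖f x‖ ∂semicircleMeasure
  have hK0 : 0 ≤ K := integral_nonneg fun _ => norm_nonneg _
  obtain ⟨p, hp⟩ := exists_polynomial_near_of_continuousOn (-2) 2 g hgc.continuousOn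
    (ε / (K + 1)) (by positivity)
  have hsub : ∫ x, g x • f x ∂semicircleMeasure =
      ∫ x, (g x - p.eval x) • f x ∂semicircleMeasure := by
    simp_rw [sub_smul]
    rw [integral_sub (integrable_smul_of_continuous hgc hf)
      (integrable_smul_of_continuous p.continuous hf), h p, sub_zero]
  rw [hsub, zero_add]
  calc ‖∫ x, (g x - p.eval x) • f x ∂semicircleMeasure‖
      ≤ ∫ x, ε / (K + 1) * ‖f x‖ ∂semicircleMeasure := by
        refine norm_integral_le_of_norm_le (hf.norm.const_mul _) ?_
        filter_upwards [ae_semicircleMeasure_mem_Icc] with x hx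
        rw [norm_smul, Real.norm_eq_abs, abs_sub_comm]
        exact mul_le_mul_of_nonneg_right (hp x hx).le (norm_nonneg _)
    _ = ε * (K / (K + 1)) := by rw [integral_const_mul]; ring
    _ ≤ ε := mul_le_of_le_one_right hε.le (div_le_one_of_le₀ (by linarith) (by positivity))

theorem span_range_chebyshevSLp_orthogonal :
    (Submodule.span ℂ (Set.range chebyshevSLp))ᗮ = ⊥ := by
  refine (Submodule.eq_bot_iff _).2 fun f hf => ?_
  have hfi : Integrable f semicircleMeasure := (Lp.memLp f).integrable (by norm_num)
  refine (Lp.eq_zero_iff_ae_eq_zero).2 (ae_eq_zero_of_integral_polynomial_smul_eq_zero hfi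
    fun p => ?_)
  have hp : p ∈ Submodule.span ℝ (Set.range fun n : ℕ => S ℝ n) :=
    span_range_chebyshevS_eq_top ▸ Submodule.mem_top
  have hint (q : ℝ[X]) := integrable_smul_of_continuous q.continuous hfi
  induction hp using Submodule.span_induction with
  | mem p hp =>
    obtain ⟨n, rfl⟩ := hp
    rw [← inner_chebyshevSLp]
    exact hf _ (Submodule.subset_span ⟨n, rfl⟩)
  | zero => simp
  | add p q _ _ hp hq =>
    simp_rw [eval_add, add_smul]
    rw [integral_add (hint p) (hint q), hp, hq, add_zero]
  | smul a p _ hp =>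
    simp_rw [eval_smul, smul_assoc]
    rw [integral_smul, hp, smul_zero]

/-- The Hilbert basis of `L²` of the semicircle measure given by the Chebyshev polynomials `S n`. -/
def chebyshevSHilbertBasis : HilbertBasis ℕ ℂ (Lp ℂ 2 semicircleMeasure) :=
  HilbertBasis.mkOfOrthogonalEqBot orthonormal_chebyshevSLp span_range_chebyshevSLp_orthogonal

theorem chebyshevSHilbertBasis_repr_apply (f : Lp ℂ 2 semicircleMeasure) (n : ℕ) :
    chebyshevSHilbertBasis.repr f n = ∫ x, (S ℝ n).eval x • f x ∂semicircleMeasure := by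
  rw [HilbertBasis.repr_apply_apply, ← inner_chebyshevSLp, chebyshevSHilbertBasis,
    HilbertBasis.coe_mkOfOrthogonalEqBot]

/-- The adjacency operator of the infinite ray is unitarily equivalent to the operator of
multiplication by `x` on `L²(ℝ, μ)`, where `μ` is the semicircle measure. -/
theorem stmt_4
    (A : lp (fun _ : ℕ => ℂ) 2 →L[ℂ] lp (fun _ : ℕ => ℂ) 2)
    (hA : ∀ (ξ : lp (fun _ : ℕ => ℂ) 2) (n : ℕ),
      A ξ n = (if n = 0 then 0 else ξ (n - 1)) + ξ (n + 1))
    (M : Lp ℂ 2 semicircleMeasure →L[ℂ] Lp ℂ 2 semicircleMeasure)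
    (hM : ∀ f : Lp ℂ 2 semicircleMeasure,
      (M f : ℝ → ℂ) =ᵐ[semicircleMeasure] fun x => (x : ℂ) * f x) :
    ∃ U : lp (fun _ : ℕ => ℂ) 2 ≃ₗᵢ[ℂ] Lp ℂ 2 semicircleMeasure,
      ∀ ξ, U (A ξ) = M (U ξ) := by
  refine ⟨chebyshevSHilbertBasis.repr.symm, fun ξ => ?_⟩
  obtain ⟨f, rfl⟩ := chebyshevSHilbertBasis.repr.surjective ξ
  rw [LinearIsometryEquiv.symm_apply_apply, LinearIsometryEquiv.symm_apply_eq]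
  have hfi : Integrable f semicircleMeasure := (Lp.memLp f).integrable (by norm_num)
  have hint (q : ℝ[X]) := integrable_smul_of_continuous q.continuous hfi
  ext n
  have hpred : (if n = 0 then 0 else chebyshevSHilbertBasis.repr f (n - 1)) =
      ∫ x, (S ℝ ((n : ℤ) - 1)).eval x • f x ∂semicircleMeasure := by
    cases n with
    | zero => simp
    | succ m => simp [chebyshevSHilbertBasis_repr_apply]
  rw [hA, hpred, chebyshevSHilbertBasis_repr_apply, chebyshevSHilbertBasis_repr_apply,
    ← integral_add (hint _) (hint _)]
  refine integral_congr_ae ?_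
  filter_upwards [hM f] with x hx
  rw [hx, Nat.cast_add_one, S_add_one]
  simp only [eval_sub, eval_mul, eval_X, Complex.real_smul]
  push_cast
  ring
end
end

section
/- The adjacency operator A_L of the infinite line is unitarily equivalent to the direct sum A_R ⊕ A_R of two copies of the adjacency operator of the infinite ray, acting on ℓ²(ℕ, ℂ) × ℓ²(ℕ, ℂ). In other words, the line and the disjoint union of two infinite rays have unitarily equivalent adjacency operators. -/
noncomputable section

open MeasureTheory AddCircle

theorem memLp_mul_of_ae_norm_eq_one {α : Type*} [MeasurableSpace α] {μ : Measure α} {u : α → ℂ}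
    (hu : Measurable u) (hu1 : ∀ᵐ x ∂μ, ‖u x‖ = 1) (f : Lp ℂ 2 μ) :
    MemLp (fun x => u x * f x) 2 μ := by
  refine (memLp_congr_norm (hu.aestronglyMeasurable.mul (Lp.aestronglyMeasurable f))
    (Lp.aestronglyMeasurable f) ?_).2 (Lp.memLp f)
  filter_upwards [hu1] with x hx
  rw [Pi.mul_apply, norm_mul, hx, one_mul]

/-- Multiplication of `L²` functions by a measurable function that is unimodular almost
everywhere. -/
def mulUnimodular {α : Type*} [MeasurableSpace α] {μ : Measure α} (u : α → ℂ)
    (hu : Measurable u) (hu1 : ∀ᵐ x ∂μ, ‖u x‖ = 1) : Lp ℂ 2 μ →ₗᵢ[ℂ] Lp ℂ 2 μ where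
  toFun f := (memLp_mul_of_ae_norm_eq_one hu hu1 f).toLp _
  map_add' f g := by
    rw [← MemLp.toLp_add, MemLp.toLp_eq_toLp_iff]
    filter_upwards [Lp.coeFn_add f g] with x hx
    rw [hx, Pi.add_apply, mul_add, Pi.add_apply]
  map_smul' c f := by
    rw [RingHom.id_apply, ← MemLp.toLp_const_smul, MemLp.toLp_eq_toLp_iff]
    filter_upwards [Lp.coeFn_smul c f] with x hx
    rw [hx, Pi.smul_apply, Pi.smul_apply, smul_eq_mul, smul_eq_mul, mul_left_comm]
  norm_map' f := by
    change ‖(memLp_mul_of_ae_norm_eq_one hu hu1 f).toLp _‖ = ‖f‖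
    rw [Lp.norm_toLp, Lp.norm_def]
    congr 1
    refine eLpNorm_congr_norm_ae ?_
    filter_upwards [hu1] with x hx
    rw [norm_mul, hx, one_mul]

theorem coeFn_mulUnimodular {α : Type*} [MeasurableSpace α] {μ : Measure α} {u : α → ℂ}
    (hu : Measurable u) (hu1 : ∀ᵐ x ∂μ, ‖u x‖ = 1) (f : Lp ℂ 2 μ) :
    mulUnimodular u hu hu1 f =ᵐ[μ] fun x => u x * f x :=
  (memLp_mul_of_ae_norm_eq_one hu hu1 f).coeFn_toLp

/-- The sign of the sine function on the circle. -/
def signSin (x : UnitAddCircle) : ℂ :=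
  if 0 < (toCircle x : ℂ).im then 1 else if (toCircle x : ℂ).im < 0 then -1 else 0

theorem measurable_signSin : Measurable signSin := by
  have h : Measurable fun x : UnitAddCircle => (toCircle x : ℂ).im :=
    (Complex.continuous_im.comp (continuous_subtype_val.comp continuous_toCircle)).measurable
  exact Measurable.ite (measurableSet_lt measurable_const h) measurable_const
    (Measurable.ite (measurableSet_lt h measurable_const) measurable_const measurable_const)

theorem signSin_neg (x : UnitAddCircle) : signSin (-x) = -signSin x := by
  rcases lt_trichotomy (toCircle x : ℂ).im 0 with h | h | h <;>
    simp [signSin, toCircle_neg, h, h.not_gt]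

instance : (haarAddCircle : Measure UnitAddCircle).IsAddHaarMeasure :=
  inferInstanceAs (Measure.IsAddHaarMeasure (Measure.addHaarMeasure ⊤))

instance : Nontrivial UnitAddCircle :=
  ⟨0, ((1 / 2 : ℝ) : UnitAddCircle), fun h => by
    obtain ⟨n, hn⟩ := (AddCircle.coe_eq_zero_iff 1).1 h.symm
    have h2 : (n : ℝ) * 2 = 1 := by simp at hn; linarith
    have h3 : n * 2 = 1 := by exact_mod_cast h2
    omega⟩

theorem ae_norm_signSin : ∀ᵐ x ∂(haarAddCircle : Measure UnitAddCircle), ‖signSin x‖ = 1 := by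
  have hfin : (toCircle ⁻¹' {1, -1} : Set UnitAddCircle).Finite :=
    Set.Finite.preimage (injective_toCircle one_ne_zero).injOn (by simp)
  refine measure_mono_null (fun x hx => ?_) (hfin.measure_zero haarAddCircle)
  contrapose! hx
  have him : (toCircle x : ℂ).im ≠ 0 := by
    intro h0
    have h1 := Circle.normSq_coe (toCircle x)
    rw [Complex.normSq_apply, h0, mul_zero, add_zero, mul_self_eq_one_iff] at h1
    refine hx (h1.imp (fun h => ?_) fun h => ?_) <;>
      exact Circle.ext (Complex.ext (by simpa using h) (by simpa using h0))
  rcases lt_or_gt_of_ne him with h | h <;> simp [signSin, h, h.not_gt]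

theorem repr_mulUnimodular_fourier (k : ℤ) (hu : Measurable (fourier k : UnitAddCircle → ℂ))
    (hu1 : ∀ᵐ x ∂(haarAddCircle : Measure UnitAddCircle), ‖fourier k x‖ = 1)
    (f : Lp ℂ 2 (haarAddCircle : Measure UnitAddCircle)) (n : ℤ) :
    fourierBasis.repr (mulUnimodular _ hu hu1 f) n = fourierBasis.repr f (n - k) := by
  rw [fourierBasis_repr, fourierBasis_repr]
  refine integral_congr_ae ?_
  filter_upwards [coeFn_mulUnimodular hu hu1 f] with x hx
  rw [hx, smul_eq_mul, smul_eq_mul, ← mul_assoc, ← fourier_add]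
  congr 3
  ring

theorem repr_compNeg (hneg : MeasurePreserving Neg.neg
      (haarAddCircle : Measure UnitAddCircle) haarAddCircle)
    (f : Lp ℂ 2 (haarAddCircle : Measure UnitAddCircle)) (n : ℤ) :
    fourierBasis.repr (Lp.compMeasurePreserving Neg.neg hneg f) n = fourierBasis.repr f (-n) := by
  rw [fourierBasis_repr, fourierBasis_repr, fourierCoeff, fourierCoeff,
    ← integral_neg_eq_self (μ := haarAddCircle)]
  refine integral_congr_ae ?_
  filter_upwards [hneg.quasiMeasurePreserving.ae (Lp.coeFn_compMeasurePreserving f hneg)] with x hx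
  rw [hx]
  simp [fourier_apply]

/-- Multiplication by the sign of the sine function, transported to `ℓ²(ℤ)` by Fourier series, is an
isometric involution commuting with the adjacency operator of the line and anticommuting with the
reflection of the line. -/
theorem exists_anticommuting_symmetry :
    ∃ S : lp (fun _ : ℤ => ℂ) 2 →ₗᵢ[ℂ] lp (fun _ : ℤ => ℂ) 2,
      (∀ ξ, S (S ξ) = ξ) ∧
      (∀ ξ η, (∀ n, η n = ξ (n - 1) + ξ (n + 1)) → ∀ n, S η n = S ξ (n - 1) + S ξ (n + 1)) ∧
      ∀ ξ η, (∀ n, η n = ξ (-n)) → ∀ n, S η n = -S ξ (-n) := by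
  let e : Lp ℂ 2 (haarAddCircle : Measure UnitAddCircle) ≃ₗᵢ[ℂ] lp (fun _ : ℤ => ℂ) 2 :=
    fourierBasis.repr
  let M := mulUnimodular signSin measurable_signSin ae_norm_signSin
  have hM := coeFn_mulUnimodular measurable_signSin ae_norm_signSin
  have hm (k : ℤ) : Measurable (fourier k : UnitAddCircle → ℂ) :=
    (fourier k).continuous.measurable
  have hm1 (k : ℤ) : ∀ᵐ x ∂(haarAddCircle : Measure UnitAddCircle), ‖fourier k x‖ = 1 :=
    .of_forall fun x => Circle.norm_coe _
  let F (k : ℤ) := mulUnimodular _ (hm k) (hm1 k)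
  have hF (k : ℤ) := coeFn_mulUnimodular (hm k) (hm1 k)
  have heF (k : ℤ) (f) (n : ℤ) : e (F k f) n = e f (n - k) :=
    repr_mulUnimodular_fourier k (hm k) (hm1 k) f n
  have hneg := Measure.measurePreserving_neg (haarAddCircle : Measure UnitAddCircle)
  let N := Lp.compMeasurePreserving (E := ℂ) (p := 2) Neg.neg hneg
  have heN (f) (n : ℤ) : e (N f) n = e f (-n) := repr_compNeg hneg f n
  have hMF (k : ℤ) (f) : M (F k f) = F k (M f) := by
    refine Lp.ext ?_
    filter_upwards [hM (F k f), hF k (M f), hM f, hF k f] with x h1 h2 h3 h4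
    rw [h1, h2, h3, h4, mul_left_comm]
  have hMN (f) : M (N f) = -N (M f) := by
    refine Lp.ext ?_
    filter_upwards [hM (N f), Lp.coeFn_neg (N (M f)), Lp.coeFn_compMeasurePreserving f hneg,
      Lp.coeFn_compMeasurePreserving (M f) hneg,
      hneg.quasiMeasurePreserving.ae (hM f)] with x h1 h2 h3 h4 h5
    rw [h1, h2, h3, Pi.neg_apply, h4, Function.comp_apply, Function.comp_apply, h5, signSin_neg]
    ring
  refine ⟨(e.toLinearIsometry.comp M).comp e.symm.toLinearIsometry, fun ξ => ?_,
    fun ξ η h n => ?_, fun ξ η h n => ?_⟩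
  · have hMM (f) : M (M f) = f := by
      refine Lp.ext ?_
      filter_upwards [hM (M f), hM f, ae_norm_signSin] with x h1 h2 h3
      rw [h1, h2, ← mul_assoc]
      convert one_mul _
      unfold signSin at h3 ⊢
      split_ifs at h3 ⊢ <;> simp_all
    simp [hMM]
  · have hη : e.symm η = F 1 (e.symm ξ) + F (-1) (e.symm ξ) := by
      rw [LinearIsometryEquiv.symm_apply_eq]
      ext n
      rw [map_add, lp.coeFn_add, Pi.add_apply, heF, heF, e.apply_symm_apply, h, sub_neg_eq_add]
    change e (M (e.symm η)) n = e (M (e.symm ξ)) (n - 1) + e (M (e.symm ξ)) (n + 1)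
    rw [hη, map_add, hMF, hMF, map_add, lp.coeFn_add, Pi.add_apply, heF, heF, sub_neg_eq_add]
  · have hη : e.symm η = N (e.symm ξ) := by
      rw [LinearIsometryEquiv.symm_apply_eq]
      ext n
      rw [heN, e.apply_symm_apply, h]
    change e (M (e.symm η)) n = -e (M (e.symm ξ)) (-n)
    rw [hη, hMN, map_neg, lp.coeFn_neg, Pi.neg_apply, heN]

/-- The odd sequence on `ℤ` whose value at `k + 1` is `x k / √2`. -/
def oddExtensionFun (x : ℕ → ℂ) : ℤ → ℂ
  | Int.ofNat 0 => 0
  | Int.ofNat (k + 1) => (√2 : ℂ)⁻¹ * x k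
  | Int.negSucc k => -((√2 : ℂ)⁻¹ * x k)

theorem oddExtensionFun_neg (x : ℕ → ℂ) (n : ℤ) :
    oddExtensionFun x (-n) = -oddExtensionFun x n := by
  rcases n with (_ | k) | k
  · simp [oddExtensionFun]
  · rfl
  · exact (neg_neg _).symm

theorem oddExtensionFun_add (x y : ℕ → ℂ) (n : ℤ) :
    oddExtensionFun (x + y) n = oddExtensionFun x n + oddExtensionFun y n := by
  rcases n with (_ | k) | k <;> simp only [oddExtensionFun, Pi.add_apply] <;> ring

theorem oddExtensionFun_smul (c : ℂ) (x : ℕ → ℂ) (n : ℤ) :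
    oddExtensionFun (c • x) n = c * oddExtensionFun x n := by
  rcases n with (_ | k) | k <;> simp only [oddExtensionFun, Pi.smul_apply, smul_eq_mul] <;> ring

theorem hasSum_norm_sq_oddExtensionFun (x : lp (fun _ : ℕ => ℂ) 2) :
    HasSum (fun n => ‖oddExtensionFun x n‖ ^ 2) (‖x‖ ^ 2) := by
  have hx : HasSum (fun k => ‖(√2 : ℂ)⁻¹ * x k‖ ^ 2) (‖x‖ ^ 2 / 2) := by
    have := (lp.hasSum_norm (by simp) x).mul_left (1 / 2)
    simp only [ENNReal.toReal_ofNat, Real.rpow_ofNat] at this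
    convert! this using 1
    · ext k
      simp [mul_pow]
    · ring
  rw [← add_halves (‖x‖ ^ 2)]
  refine HasSum.of_nat_of_neg_add_one ?_ ?_
  · rw [← hasSum_nat_add_iff' 1]
    simpa [oddExtensionFun] using hx
  · convert! hx using 1
    ext k
    rw [oddExtensionFun_neg, norm_neg]
    rfl

theorem memℓp_oddExtensionFun (x : lp (fun _ : ℕ => ℂ) 2) :
    Memℓp (E := fun _ : ℤ => ℂ) (oddExtensionFun x) 2 :=
  memℓp_gen <| by simpa using (hasSum_norm_sq_oddExtensionFun x).summable

/-- The isometric embedding of `ℓ²(ℕ)` in `ℓ²(ℤ)` onto the odd sequences. -/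
def oddExtension : lp (fun _ : ℕ => ℂ) 2 →ₗᵢ[ℂ] lp (fun _ : ℤ => ℂ) 2 where
  toFun x := ⟨oddExtensionFun x, memℓp_oddExtensionFun x⟩
  map_add' x y := lp.ext <| funext <| oddExtensionFun_add x y
  map_smul' c x := lp.ext <| funext <| oddExtensionFun_smul c x
  norm_map' x := by
    refine (sq_eq_sq₀ (norm_nonneg _) (norm_nonneg _)).1 ?_
    refine HasSum.unique ?_ (hasSum_norm_sq_oddExtensionFun x)
    simpa using lp.hasSum_norm (p := 2) (by simp)
      (⟨oddExtensionFun x, memℓp_oddExtensionFun x⟩ : lp (fun _ : ℤ => ℂ) 2)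

theorem oddExtension_neg (x : lp (fun _ : ℕ => ℂ) 2) (n : ℤ) :
    oddExtension x (-n) = -oddExtension x n :=
  oddExtensionFun_neg x n

theorem oddExtension_apply_succ (x : lp (fun _ : ℕ => ℂ) 2) (k : ℕ) :
    oddExtension x ((k : ℤ) + 1) = (√2 : ℂ)⁻¹ * x k :=
  rfl

theorem oddExtension_zero_apply (x : lp (fun _ : ℕ => ℂ) 2) : oddExtension x 0 = 0 :=
  rfl

theorem inner_eq_zero_of_odd_of_even {ξ η : lp (fun _ : ℤ => ℂ) 2} (hξ : ∀ n, ξ (-n) = -ξ n)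
    (hη : ∀ n, η (-n) = η n) : inner ℂ ξ η = 0 := by
  rw [← self_eq_neg, lp.inner_eq_tsum, ← tsum_neg, ← (Equiv.neg ℤ).tsum_eq]
  refine tsum_congr fun n => ?_
  rw [Equiv.neg_apply, hξ, hη, inner_neg_left]

theorem oddExtension_shift {AR : lp (fun _ : ℕ => ℂ) 2 →L[ℂ] lp (fun _ : ℕ => ℂ) 2}
    (hAR : ∀ (ξ : lp (fun _ : ℕ => ℂ) 2) (n : ℕ),
      AR ξ n = (if n = 0 then 0 else ξ (n - 1)) + ξ (n + 1))
    (x : lp (fun _ : ℕ => ℂ) 2) (n : ℤ) :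
    oddExtension (AR x) n = oddExtension x (n - 1) + oddExtension x (n + 1) := by
  have hsucc (k : ℕ) : oddExtension (AR x) ((k : ℤ) + 1) =
      oddExtension x ((k : ℤ) + 1 - 1) + oddExtension x ((k : ℤ) + 1 + 1) := by
    rw [oddExtension_apply_succ, hAR, add_sub_cancel_right, mul_add]
    congr 1
    rcases k with _ | k
    · simp [oddExtension_zero_apply]
    · simp [oddExtension_apply_succ]
  rcases n with (_ | k) | k
  · simp [oddExtension_zero_apply, oddExtension_neg]
  · exact hsucc k
  · have h1 : -((k : ℤ) + 1) - 1 = -((k : ℤ) + 1 + 1) := by ring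
    have h2 : -((k : ℤ) + 1) + 1 = -((k : ℤ) + 1 - 1) := by ring
    rw [Int.negSucc_eq, h1, h2, oddExtension_neg, oddExtension_neg, oddExtension_neg, hsucc]
    ring

theorem exists_eq_oddExtension {ξ : lp (fun _ : ℤ => ℂ) 2} (hξ : ∀ n, ξ (-n) = -ξ n) :
    ∃ x, oddExtension x = ξ := by
  have hmem : Memℓp (fun k : ℕ => (√2 : ℂ) * ξ ((k : ℤ) + 1)) 2 := by
    have h := (lp.memℓp ξ).summable (by simp)
    refine Memℓp.const_mul (memℓp_gen ?_) _
    exact h.comp_injective (i := fun k : ℕ => (k : ℤ) + 1) fun a b hab => by simpa using hab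
  have hsucc (k : ℕ) : oddExtension ⟨_, hmem⟩ ((k : ℤ) + 1) = ξ ((k : ℤ) + 1) := by
    rw [oddExtension_apply_succ]
    simp
  refine ⟨⟨_, hmem⟩, ?_⟩
  ext n
  rcases n with (_ | k) | k
  · have h0 := hξ 0
    rw [neg_zero, self_eq_neg] at h0
    exact h0.symm
  · exact hsucc k
  · rw [Int.negSucc_eq, oddExtension_neg, hξ, hsucc]

theorem exists_odd_add_even (ξ : lp (fun _ : ℤ => ℂ) 2) :
    ∃ α β : lp (fun _ : ℤ => ℂ) 2,
      (∀ n, α (-n) = -α n) ∧ (∀ n, β (-n) = β n) ∧ α + β = ξ := by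
  have hmem : Memℓp (fun n : ℤ => ξ (-n)) 2 :=
    memℓp_gen <| ((lp.memℓp ξ).summable (by simp)).comp_injective neg_injective
  let ρ : lp (fun _ : ℤ => ℂ) 2 := ⟨_, hmem⟩
  have hρ (n : ℤ) : ρ n = ξ (-n) := rfl
  refine ⟨(2⁻¹ : ℂ) • (ξ - ρ), (2⁻¹ : ℂ) • (ξ + ρ), fun n => ?_, fun n => ?_, ?_⟩
  · simp only [lp.coeFn_smul, lp.coeFn_sub, Pi.smul_apply, Pi.sub_apply, hρ, neg_neg, smul_eq_mul]
    ring
  · simp only [lp.coeFn_smul, lp.coeFn_add, Pi.smul_apply, Pi.add_apply, hρ, neg_neg, smul_eq_mul]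
    ring
  · module

/-- The adjacency operator of the infinite line is unitarily equivalent to the direct sum of
two copies of the adjacency operator of the infinite ray, acting on `ℓ²(ℕ) × ℓ²(ℕ)` (with the
`L²` product norm). -/
theorem stmt_9
    (AL : lp (fun _ : ℤ => ℂ) 2 →L[ℂ] lp (fun _ : ℤ => ℂ) 2)
    (hAL : ∀ (ξ : lp (fun _ : ℤ => ℂ) 2) (n : ℤ), AL ξ n = ξ (n - 1) + ξ (n + 1))
    (AR : lp (fun _ : ℕ => ℂ) 2 →L[ℂ] lp (fun _ : ℕ => ℂ) 2)
    (hAR : ∀ (ξ : lp (fun _ : ℕ => ℂ) 2) (n : ℕ),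
      AR ξ n = (if n = 0 then 0 else ξ (n - 1)) + ξ (n + 1))
    (B : WithLp 2 (lp (fun _ : ℕ => ℂ) 2 × lp (fun _ : ℕ => ℂ) 2) →L[ℂ]
         WithLp 2 (lp (fun _ : ℕ => ℂ) 2 × lp (fun _ : ℕ => ℂ) 2))
    (hB : ∀ ξ : WithLp 2 (lp (fun _ : ℕ => ℂ) 2 × lp (fun _ : ℕ => ℂ) 2),
      WithLp.equiv 2 (lp (fun _ : ℕ => ℂ) 2 × lp (fun _ : ℕ => ℂ) 2) (B ξ) =
        (AR (WithLp.equiv 2 (lp (fun _ : ℕ => ℂ) 2 × lp (fun _ : ℕ => ℂ) 2) ξ).1,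
         AR (WithLp.equiv 2 (lp (fun _ : ℕ => ℂ) 2 × lp (fun _ : ℕ => ℂ) 2) ξ).2)) :
    ∃ U : lp (fun _ : ℤ => ℂ) 2 ≃ₗᵢ[ℂ]
        WithLp 2 (lp (fun _ : ℕ => ℂ) 2 × lp (fun _ : ℕ => ℂ) 2),
      ∀ ξ, U (AL ξ) = B (U ξ) := by
  obtain ⟨S, hSS, hSA, hSR⟩ := exists_anticommuting_symmetry
  have hS_odd {ξ : lp (fun _ : ℤ => ℂ) 2} (h : ∀ n, ξ (-n) = -ξ n) (n : ℤ) :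
      S ξ (-n) = S ξ n := by
    have := hSR ξ (-ξ) (fun n => (h n).symm) n
    rw [map_neg, lp.coeFn_neg, Pi.neg_apply, neg_inj] at this
    exact this.symm
  have hS_even {ξ : lp (fun _ : ℤ => ℂ) 2} (h : ∀ n, ξ (-n) = ξ n) (n : ℤ) :
      S ξ (-n) = -S ξ n := by
    rw [hSR ξ ξ (fun n => (h n).symm) n, neg_neg]
  have hAJ (x : lp (fun _ : ℕ => ℂ) 2) : AL (oddExtension x) = oddExtension (AR x) := by
    ext n
    rw [hAL, oddExtension_shift hAR]
  have hAS (ξ : lp (fun _ : ℤ => ℂ) 2) : AL (S ξ) = S (AL ξ) := by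
    ext n
    rw [hAL, hSA ξ (AL ξ) (hAL ξ)]
  let V : WithLp 2 (lp (fun _ : ℕ => ℂ) 2 × lp (fun _ : ℕ => ℂ) 2) →ₗᵢ[ℂ]
      lp (fun _ : ℤ => ℂ) 2 :=
    { toFun := fun p => oddExtension p.fst + S (oddExtension p.snd)
      map_add' := fun p q => by
        simp only [WithLp.add_fst, WithLp.add_snd, map_add]
        abel
      map_smul' := fun c p => by
        simp only [WithLp.smul_fst, WithLp.smul_snd, map_smul, smul_add, RingHom.id_apply]
      norm_map' := fun p => by
        refine (sq_eq_sq₀ (norm_nonneg _) (norm_nonneg _)).1 ?_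
        rw [WithLp.prod_norm_sq_eq_of_L2, ← oddExtension.norm_map p.fst,
          ← oddExtension.norm_map p.snd, ← S.norm_map (oddExtension p.snd), sq, sq, sq]
        exact norm_add_sq_eq_norm_sq_add_norm_sq_of_inner_eq_zero _ _
          (inner_eq_zero_of_odd_of_even (oddExtension_neg _) (hS_odd (oddExtension_neg _))) }
  have hV (p) : V p = oddExtension p.fst + S (oddExtension p.snd) := rfl
  have hsurj : Function.Surjective V := fun ξ => by
    obtain ⟨α, β, hα, hβ, rfl⟩ := exists_odd_add_even ξ
    obtain ⟨x, rfl⟩ := exists_eq_oddExtension hα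
    obtain ⟨y, hy⟩ := exists_eq_oddExtension (hS_even hβ)
    exact ⟨WithLp.toLp 2 (x, y), by rw [hV, WithLp.toLp_snd, hy, hSS, WithLp.toLp_fst]⟩
  have hVB (p) : AL (V p) = V (B p) := by
    have h1 : (B p).fst = AR p.fst := congrArg Prod.fst (hB p)
    have h2 : (B p).snd = AR p.snd := congrArg Prod.snd (hB p)
    rw [hV, hV, h1, h2, map_add, hAS, hAJ, hAJ]
  refine ⟨(LinearIsometryEquiv.ofSurjective V hsurj).symm, fun ξ => ?_⟩
  obtain ⟨p, rfl⟩ := (LinearIsometryEquiv.ofSurjective V hsurj).surjective ξ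
  rw [LinearIsometryEquiv.symm_apply_apply, LinearIsometryEquiv.symm_apply_eq]
  exact hVB p
end
end

section
/- Let A_D be the adjacency operator of the graph D_∞. Then the spectrum of A_D is the closed interval [−2, 2], and 0 is an eigenvalue of A_D (an eigenvector is the vector taking value 1 at the vertex 0, value −1 at the vertex 0′, and 0 at all other vertices). -/
noncomputable section

/-- A sum over `Option ℕ` splits off the value at `none`. -/
theorem hasSum_option_nat {f : Option ℕ → ℝ} {T : ℝ} (h : HasSum (fun n => f (some n)) T) :
    HasSum f (f none + T) := by
  have h₁ : HasSum (fun i : Option ℕ => if i = none then f none else 0) (f none) :=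
    hasSum_ite_eq none (f none)
  have h₂ : HasSum (fun i : Option ℕ => if i = none then 0 else f i) T := by
    refine ((Option.some_injective ℕ).hasSum_iff ?_).1 (by simpa [Function.comp_def] using h)
    rintro (_ | n) hn
    · simp
    · simp at hn
  refine (h₁.add h₂).congr_fun ?_
  rintro (_ | n) <;> simp

theorem hasSum_sq_norm (ξ : lp (fun _ : Option ℕ => ℂ) 2) :
    HasSum (fun i => ‖ξ i‖ ^ 2) (‖ξ‖ ^ 2) := by
  simpa using lp.hasSum_norm (p := 2) (by norm_num) ξ

theorem exists_hasSum_sq_norm_some (ξ : lp (fun _ : Option ℕ => ℂ) 2) :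
    ∃ T, HasSum (fun n : ℕ => ‖ξ (some n)‖ ^ 2) T ∧ ‖ξ‖ ^ 2 = ‖ξ none‖ ^ 2 + T := by
  obtain ⟨T, hT⟩ := (hasSum_sq_norm ξ).summable.comp_injective (Option.some_injective ℕ)
  exact ⟨T, hT, (hasSum_sq_norm ξ).unique (hasSum_option_nat hT)⟩

/-- A null sequence satisfying `x (n + 2) = t * x (n + 1) - x n` with `|t| ≤ 2` vanishes. -/
theorem eq_zero_of_recurrence_of_tendsto_zero {x : ℕ → ℝ} {t : ℝ} (ht : t ^ 2 ≤ 4)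
    (hrec : ∀ n, x (n + 2) = t * x (n + 1) - x n)
    (hx : Filter.Tendsto x Filter.atTop (nhds 0)) (n : ℕ) : x n = 0 := by
  have hx' : Filter.Tendsto (fun n => x (n + 1)) Filter.atTop (nhds 0) :=
    hx.comp (Filter.tendsto_add_atTop_nat 1)
  have hconst : ∀ n, x (n + 1) ^ 2 - t * x n * x (n + 1) + x n ^ 2 =
      x 1 ^ 2 - t * x 0 * x 1 + x 0 ^ 2 := by
    intro n
    induction n with
    | zero => simp
    | succ k ih => rw [← ih, hrec]; ring
  have hzero : x 1 ^ 2 - t * x 0 * x 1 + x 0 ^ 2 = 0 := by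
    have hlim : Filter.Tendsto (fun n => x (n + 1) ^ 2 - t * x n * x (n + 1) + x n ^ 2)
        Filter.atTop (nhds (0 ^ 2 - t * 0 * 0 + 0 ^ 2)) :=
      ((hx'.pow 2).sub ((hx.const_mul t).mul hx')).add (hx.pow 2)
    simp_rw [hconst] at hlim
    simpa using tendsto_nhds_unique tendsto_const_nhds hlim
  have hstep : ∀ n, x (n + 1) ^ 2 = x n ^ 2 := by
    intro n
    have hn := (hconst n).trans hzero
    have h₁ : (2 * x (n + 1) - t * x n) ^ 2 + (4 - t ^ 2) * x n ^ 2 = 0 := by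
      linear_combination 4 * hn
    have h₂ : 0 ≤ (4 - t ^ 2) * x n ^ 2 := mul_nonneg (by linarith) (sq_nonneg _)
    have h₃ : 2 * x (n + 1) - t * x n = 0 := by
      have := sq_nonneg (2 * x (n + 1) - t * x n)
      exact pow_eq_zero_iff two_ne_zero |>.1 (by linarith)
    linear_combination x (n + 1) * h₃ - hn
  have hsq : ∀ k, x (n + k) ^ 2 = x n ^ 2 := by
    intro k
    induction k with
    | zero => rfl
    | succ k ih => rw [← ih, ← add_assoc, hstep]
  have hlim : Filter.Tendsto (fun k => x (n + k) ^ 2) Filter.atTop (nhds (0 ^ 2)) := by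
    refine Filter.Tendsto.pow ?_ 2
    simpa only [add_comm n, Function.comp_def] using hx.comp (Filter.tendsto_add_atTop_nat n)
  simp_rw [hsq] at hlim
  simpa using tendsto_nhds_unique tendsto_const_nhds hlim

/-- `A` acts as the adjacency operator of `D_∞`. -/
def IsAdjacencyD (A : lp (fun _ : Option ℕ => ℂ) 2 →L[ℂ] lp (fun _ : Option ℕ => ℂ) 2) : Prop :=
  ∀ ξ : lp (fun _ : Option ℕ => ℂ) 2,
    A ξ none = ξ (some 1) ∧
    ∀ n : ℕ, A ξ (some n) =
      (if n = 0 then 0 else ξ (some (n - 1))) + ξ (some (n + 1)) +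
        (if n = 1 then ξ none else 0)

namespace IsAdjacencyD

variable {A : lp (fun _ : Option ℕ => ℂ) 2 →L[ℂ] lp (fun _ : Option ℕ => ℂ) 2}

theorem apply_none (hA : IsAdjacencyD A) (ξ : lp (fun _ : Option ℕ => ℂ) 2) :
    A ξ none = ξ (some 1) := (hA ξ).1

theorem apply_zero (hA : IsAdjacencyD A) (ξ : lp (fun _ : Option ℕ => ℂ) 2) :
    A ξ (some 0) = ξ (some 1) := by simpa using (hA ξ).2 0

theorem apply_one (hA : IsAdjacencyD A) (ξ : lp (fun _ : Option ℕ => ℂ) 2) :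
    A ξ (some 1) = ξ (some 0) + ξ (some 2) + ξ none := by simpa using (hA ξ).2 1

theorem apply_add_two (hA : IsAdjacencyD A) (ξ : lp (fun _ : Option ℕ => ℂ) 2) (n : ℕ) :
    A ξ (some (n + 2)) = ξ (some (n + 1)) + ξ (some (n + 3)) := by
  simpa using (hA ξ).2 (n + 2)

/-- The weighted Cauchy–Schwarz estimate behind the norm bound uses the positive vector with
values `1` at the two leaves and `2` elsewhere, an eigenvector for the eigenvalue `2`. -/
theorem norm_le_two (hA : IsAdjacencyD A) : ‖A‖ ≤ 2 := by
  refine A.opNorm_le_bound zero_le_two fun ξ => ?_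
  obtain ⟨T, hT, hξ⟩ := exists_hasSum_sq_norm_some ξ
  obtain ⟨S, hS, hAξ⟩ := exists_hasSum_sq_norm_some (A ξ)
  have two (z w : ℂ) : ‖z + w‖ ^ 2 ≤ 2 * ‖z‖ ^ 2 + 2 * ‖w‖ ^ 2 := by
    nlinarith [norm_add_le z w, norm_nonneg (z + w), sq_nonneg (‖z‖ - ‖w‖)]
  have hone : ‖A ξ (some 1)‖ ^ 2 ≤
      4 * ‖ξ none‖ ^ 2 + 4 * ‖ξ (some 0)‖ ^ 2 + 2 * ‖ξ (some 2)‖ ^ 2 := by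
    rw [hA.apply_one, show ξ (some 0) + ξ (some 2) + ξ none =
      (ξ (some 0) + ξ none) + ξ (some 2) by ring]
    linarith [two (ξ (some 0) + ξ none) (ξ (some 2)), two (ξ (some 0)) (ξ none)]
  have hS₂ := (hasSum_nat_add_iff' 2).2 hS
  have hT₁ := (hasSum_nat_add_iff' 1).2 hT
  have hT₃ := (hasSum_nat_add_iff' 3).2 hT
  have hle := hasSum_le (fun n => by
    rw [hA.apply_add_two]
    exact two _ _) hS₂ ((hT₁.mul_left 2).add (hT₃.mul_left 2))
  simp only [Finset.sum_range_succ, Finset.sum_range_zero, hA.apply_zero, zero_add] at hle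
  have hn := hA.apply_none ξ
  refine le_of_sq_le_sq ?_ (by positivity)
  rw [mul_pow, hAξ, hξ, hn]
  linarith

theorem apply_single_none (hA : IsAdjacencyD A) :
    A (lp.single 2 none 1) = lp.single 2 (some 1) 1 := by
  ext (_ | _ | _ | n) <;>
    simp [hA.apply_none, hA.apply_zero, hA.apply_one, hA.apply_add_two]

theorem apply_single_zero (hA : IsAdjacencyD A) :
    A (lp.single 2 (some 0) 1) = lp.single 2 (some 1) 1 := by
  ext (_ | _ | _ | n) <;>
    simp [hA.apply_none, hA.apply_zero, hA.apply_one, hA.apply_add_two]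

theorem apply_single_one (hA : IsAdjacencyD A) :
    A (lp.single 2 (some 1) 1) =
      lp.single 2 (some 0) 1 + lp.single 2 (some 2) 1 + lp.single 2 none 1 := by
  ext (_ | _ | _ | n) <;>
    simp [hA.apply_none, hA.apply_zero, hA.apply_one, hA.apply_add_two, Pi.single_apply]

theorem apply_single_add_two (hA : IsAdjacencyD A) (n : ℕ) :
    A (lp.single 2 (some (n + 2)) 1) =
      lp.single 2 (some (n + 1)) 1 + lp.single 2 (some (n + 3)) 1 := by
  ext (_ | _ | _ | m) <;>
    simp [hA.apply_none, hA.apply_zero, hA.apply_one, hA.apply_add_two, Pi.single_apply]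
  grind

theorem isSelfAdjoint (hA : IsAdjacencyD A) : IsSelfAdjoint A := by
  have key (i : Option ℕ) (ξ : lp (fun _ : Option ℕ => ℂ) 2) :
      ContinuousLinearMap.adjoint A ξ i = inner ℂ (A (lp.single 2 i 1)) ξ := by
    rw [← ContinuousLinearMap.adjoint_inner_right, lp.inner_single_left]
    simp
  rw [ContinuousLinearMap.isSelfAdjoint_iff']
  ext ξ i
  rw [key]
  rcases i with _ | _ | _ | n
  · simp [hA.apply_single_none, hA.apply_none, lp.inner_single_left]
  · simp [hA.apply_single_zero, hA.apply_zero, lp.inner_single_left]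
  · simp [hA.apply_single_one, hA.apply_one, lp.inner_single_left]
  · simp [hA.apply_single_add_two, hA.apply_add_two, lp.inner_single_left]

theorem spectrum_subset (hA : IsAdjacencyD A) :
    spectrum ℂ A ⊆ Complex.ofReal '' Set.Icc (-2 : ℝ) 2 := by
  intro z hz
  have : Nontrivial (lp (fun _ : Option ℕ => ℂ) 2) := by
    refine ⟨lp.single 2 none 1, 0, fun h => ?_⟩
    have := congrArg (fun ξ : lp (fun _ : Option ℕ => ℂ) 2 => ξ none) h
    simp at this
  have hre := hA.isSelfAdjoint.mem_spectrum_eq_re hz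
  have hle : |z.re| ≤ 2 :=
    (Complex.abs_re_le_norm z).trans ((spectrum.norm_le_norm_of_mem hz).trans hA.norm_le_two)
  exact ⟨z.re, abs_le.1 hle, hre.symm⟩

theorem subset_spectrum (hA : IsAdjacencyD A) :
    Complex.ofReal '' Set.Icc (-2 : ℝ) 2 ⊆ spectrum ℂ A := by
  rintro _ ⟨t, ht, rfl⟩ hres
  rw [spectrum.mem_resolventSet_iff] at hres
  obtain ⟨B, hB⟩ := hres.exists_right_inv
  set ζ : lp (fun _ : Option ℕ => ℂ) 2 := lp.single 2 none 1 + lp.single 2 (some 0) 1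
  set ξ := B ζ
  have heq : (t : ℂ) • ξ - A ξ = ζ := congrArg (fun C => C ζ) hB
  have hcoord (i : Option ℕ) : t * (ξ i).re - (A ξ i).re = (ζ i).re := by
    rw [← heq, lp.coeFn_sub, lp.coeFn_smul]
    simp
  have hn := hcoord none
  have h0 := hcoord (some 0)
  have h1 := hcoord (some 1)
  have h2 (n : ℕ) := hcoord (some (n + 2))
  simp [ζ, hA.apply_none, hA.apply_zero, hA.apply_one, hA.apply_add_two] at hn h0 h1 h2
  have hlim : Filter.Tendsto (fun n : ℕ => (ξ (some (n + 1))).re) Filter.atTop (nhds 0) := by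
    obtain ⟨T, hT, -⟩ := exists_hasSum_sq_norm_some ξ
    have h := (hT.summable.tendsto_atTop_zero.comp (Filter.tendsto_add_atTop_nat 1)).sqrt
    refine squeeze_zero_norm (fun n => ?_) (by simpa using h)
    simpa using Complex.abs_re_le_norm (ξ (some (n + 1)))
  have hzero := eq_zero_of_recurrence_of_tendsto_zero (t := t) (by nlinarith [ht.1, ht.2])
    (fun n => by linarith [h2 n]) hlim
  have hz1 := hzero 0
  have hz2 := hzero 1
  simp only [Nat.reduceAdd] at hz1 hz2
  rw [hz1] at hn h0 h1
  rw [hz2] at h1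
  have hsum : (ξ (some 0)).re + (ξ none).re = 0 := by linarith
  have : t * ((ξ (some 0)).re + (ξ none).re) = 2 := by linarith
  rw [hsum] at this
  norm_num at this

end IsAdjacencyD

/-- The adjacency operator of the graph `D_∞` (vertex set `{0′} ∪ ℕ`, modelled as `Option ℕ`
with `none = 0′`, edges `{0′,1}` and `{n, n+1}` for `n ∈ ℕ`) has spectrum `[-2, 2]`, and `0`
is an eigenvalue, with eigenvector taking value `1` at the vertex `0`, `-1` at the vertex
`0′`, and `0` elsewhere. -/
theorem stmt_13
    (A : lp (fun _ : Option ℕ => ℂ) 2 →L[ℂ] lp (fun _ : Option ℕ => ℂ) 2)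
    (hA : ∀ ξ : lp (fun _ : Option ℕ => ℂ) 2,
      A ξ none = ξ (some 1) ∧
      ∀ n : ℕ, A ξ (some n) =
        (if n = 0 then 0 else ξ (some (n - 1))) + ξ (some (n + 1)) +
          (if n = 1 then ξ none else 0)) :
    spectrum ℂ A = Complex.ofReal '' Set.Icc (-2 : ℝ) 2 ∧
      ∃ η : lp (fun _ : Option ℕ => ℂ) 2,
        η ≠ 0 ∧ A η = 0 ∧
        η none = -1 ∧ η (some 0) = 1 ∧ ∀ n : ℕ, n ≠ 0 → η (some n) = 0 := by
  have hD : IsAdjacencyD A := hA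
  refine ⟨hD.spectrum_subset.antisymm hD.subset_spectrum,
    lp.single 2 (some 0) 1 - lp.single 2 none 1, ?_, ?_, ?_, ?_, ?_⟩
  · intro h
    have := congrArg (fun ξ : lp (fun _ : Option ℕ => ℂ) 2 => ξ none) h
    simp at this
  · rw [map_sub, hD.apply_single_zero, hD.apply_single_none, sub_self]
  · simp
  · simp
  · intro n hn
    simp [hn]
end
end

section
/- Let G be an infinite connected simple graph on a countable vertex set with uniformly bounded vertex degrees, and let A_G be its adjacency operator on ℓ²(V, ℂ). If the operator norm of A_G is at most 2, then it equals 2, the spectrum of A_G is the closed interval [−2, 2], and G is isomorphic (as a simple graph) to one of the following three graphs: the infinite ray R, the graph D_∞, or the infinite line L. -/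
noncomputable section

/-- The infinite ray: the simple graph on `ℕ` in which `m` and `n` are adjacent iff
`|m - n| = 1`. -/
def rayGraph : SimpleGraph ℕ := SimpleGraph.fromRel fun m n => n = m + 1

/-- The infinite line: the simple graph on `ℤ` in which `m` and `n` are adjacent iff
`|m - n| = 1`. -/
def lineGraph : SimpleGraph ℤ := SimpleGraph.fromRel fun m n => n = m + 1

/-- The graph `D_∞`: vertex set `{0′} ∪ ℕ` (modelled as `Option ℕ` with `none = 0′`),
with edges `{0′, 1}` and `{n, n+1}` for `n ∈ ℕ`. -/
def dInftyGraph : SimpleGraph (Option ℕ) :=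
  SimpleGraph.fromRel fun u v =>
    (∃ n : ℕ, u = some n ∧ v = some (n + 1)) ∨ (u = none ∧ v = some 1)

/-- `G` admits no finitely supported function `c` that is positive on a nonempty finite set `S`
of vertices and satisfies `2 c ≤ A_G c` there. Vertices are labelled by natural numbers through
`x`, and `N i` is a set of labels of neighbours of the vertex labelled `i`. -/
def NoFiniteSubharmonic {V : Type*} (G : SimpleGraph V) : Prop :=
  ∀ (S : Finset ℕ) (x : ℕ → V) (c : ℕ → ℝ) (N : ℕ → Finset ℕ), S.Nonempty →
    Set.InjOn x S → (∀ i ∈ S, 0 < c i) → (∀ i ∈ S, N i ⊆ S) →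
    (∀ i ∈ S, ∀ j ∈ N i, G.Adj (x i) (x j)) → ¬ ∀ i ∈ S, 2 * c i ≤ ∑ j ∈ N i, c j

/-- An injective one-sided infinite path in `G`. -/
structure IsRay {V : Type*} (G : SimpleGraph V) (p : ℕ → V) : Prop where
  injective : Function.Injective p
  adj : ∀ n, G.Adj (p n) (p (n + 1))

/-- The sequence `p` with `w` put in front. -/
def consSeq {V : Type*} (w : V) (p : ℕ → V) : ℕ → V
  | 0 => w
  | n + 1 => p n

namespace IsRay

variable {V : Type*} {G : SimpleGraph V} {p : ℕ → V}

theorem shift (hp : IsRay G p) (k : ℕ) : IsRay G fun n => p (n + k) where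
  injective m n h := by simpa using hp.injective h
  adj n := by
    have := hp.adj (n + k)
    rwa [add_right_comm] at this

theorem cons (hp : IsRay G p) {w : V} (hw : ∀ n, p n ≠ w) (hadj : G.Adj w (p 0)) :
    IsRay G (consSeq w p) where
  injective := by
    rintro (_ | m) (_ | n) h
    · rfl
    · exact absurd h.symm (hw n)
    · exact absurd h (hw m)
    · rw [hp.injective h]
  adj := by
    rintro (_ | n)
    · exact hadj
    · exact hp.adj n

theorem not_adj_zero (hG : NoFiniteSubharmonic G) (hp : IsRay G p) {k : ℕ} (hk : 2 ≤ k) :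
    ¬ G.Adj (p 0) (p k) := by
  intro h
  refine hG (Finset.range (k + 1)) p (fun _ => 1)
    (fun i => if i = 0 then {1, k} else if i = k then {k - 1, 0} else {i - 1, i + 1})
    ⟨0, by simp⟩ hp.injective.injOn (fun _ _ => one_pos) ?_ ?_ ?_
  · intro i hi j hj
    simp only [Finset.mem_range] at *
    split_ifs at hj <;> simp only [Finset.mem_insert, Finset.mem_singleton] at hj <;> omega
  · intro i hi j hj
    simp only [Finset.mem_range] at *
    split_ifs at hj with h0 h1 <;> simp only [Finset.mem_insert, Finset.mem_singleton] at hj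
    · subst h0
      rcases hj with rfl | rfl
      · exact hp.adj 0
      · exact h
    · subst h1
      rcases hj with rfl | rfl
      · have := hp.adj (i - 1)
        rw [Nat.sub_add_cancel (by omega)] at this
        exact this.symm
      · exact h.symm
    · rcases hj with rfl | rfl
      · have := hp.adj (i - 1)
        rw [Nat.sub_add_cancel (by omega)] at this
        exact this.symm
      · exact hp.adj i
  · intro i hi
    simp only [Finset.mem_range] at hi
    split_ifs with h0 h1 <;> rw [Finset.sum_pair (by omega)] <;> norm_num

theorem adj_iff (hG : NoFiniteSubharmonic G) (hp : IsRay G p) {m n : ℕ} :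
    G.Adj (p m) (p n) ↔ n = m + 1 ∨ m = n + 1 := by
  have key : ∀ {m n : ℕ}, m < n → G.Adj (p m) (p n) → n = m + 1 := by
    intro m n hmn h
    by_contra hne
    refine (hp.shift m).not_adj_zero hG (k := n - m) (by omega) ?_
    simpa [Nat.sub_add_cancel hmn.le] using h
  constructor
  · intro h
    rcases lt_trichotomy m n with hmn | rfl | hmn
    · exact Or.inl (key hmn h)
    · exact absurd h G.irrefl
    · exact Or.inr (key hmn h.symm)
  · rintro (rfl | rfl)
    · exact hp.adj m
    · exact (hp.adj n).symm

theorem exists_eq_of_adj_two (hG : NoFiniteSubharmonic G) (hp : IsRay G p) {w : V}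
    (h : G.Adj (p 2) w) : ∃ n, p n = w := by
  by_contra! hw
  refine hG (Finset.range 9) (fun i => if i = 8 then w else p i)
    (fun i => [2, 4, 6, 5, 4, 3, 2, 1, 3].getD i 0)
    (fun i => [{1}, {0, 2}, {1, 3, 8}, {2, 4}, {3, 5}, {4, 6}, {5, 7}, {6}, {2}].getD i ∅)
    ⟨0, by simp⟩ ?_ ?_ ?_ ?_ ?_
  · intro i _ j _ hij
    simp only at hij
    split_ifs at hij with h1 h2 h2
    · rw [h1, h2]
    · exact absurd hij.symm (hw j)
    · exact absurd hij (hw i)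
    · exact hp.injective hij
  · intro i hi
    simp only [Finset.mem_range] at hi
    interval_cases i <;> simp
  · decide
  · intro i hi
    simp only [Finset.mem_range] at hi
    interval_cases i <;> simp [hp.adj_iff hG, h, h.symm]
  · intro i hi
    simp only [Finset.mem_range] at hi
    interval_cases i <;> norm_num

theorem exists_eq_of_adj (hG : NoFiniteSubharmonic G) (hp : IsRay G p) {n : ℕ} (hn : 2 ≤ n)
    {w : V} (h : G.Adj (p n) w) : ∃ m, p m = w := by
  obtain ⟨m, hm⟩ := (hp.shift (n - 2)).exists_eq_of_adj_two hG (w := w) (by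
    simpa [Nat.add_sub_cancel' hn] using h)
  exact ⟨_, hm⟩

/-- A vertex off a ray that is adjacent to the second vertex of the ray is a leaf. -/
theorem eq_of_adj_branch (hG : NoFiniteSubharmonic G) (hp : IsRay G p) {w : V}
    (hw : ∀ n, p n ≠ w) (hadj : G.Adj w (p 1)) {u : V} (hu : G.Adj w u) : u = p 1 := by
  by_contra hne
  have hq : IsRay G (consSeq w fun n => p (n + 1)) := (hp.shift 1).cons (fun n => hw _) hadj
  by_cases hup : ∃ n, p n = u
  · obtain ⟨n, rfl⟩ := hup
    rcases n with _ | _ | n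
    · exact (hp.cons hw hu).not_adj_zero hG le_rfl hadj
    · exact hne rfl
    · obtain ⟨m, hm⟩ := hp.exists_eq_of_adj hG (by omega) hu.symm
      exact hw m hm
  · push Not at hup
    have hr := hq.cons (w := u) (by
      rintro (_ | n)
      · exact hu.ne
      · exact hup _) hu.symm
    obtain ⟨m, hm⟩ := hr.exists_eq_of_adj_two hG (w := p 0) (hp.adj 0).symm
    rcases m with _ | _ | m
    · exact hup 0 hm.symm
    · exact hw 0 hm.symm
    · exact absurd (hp.injective hm) (by omega)

theorem eq_of_adj_one (hG : NoFiniteSubharmonic G) (hp : IsRay G p) {w y : V}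
    (hw : ∀ n, p n ≠ w) (hadj : G.Adj (p 1) w) (hy : ∀ n, p n ≠ y) (hyadj : G.Adj (p 1) y) :
    y = w := by
  by_contra hne
  refine hG (Finset.range 5) (fun i => [p 0, p 1, p 2, w, y].getD i w)
    (fun i => [1, 2, 1, 1, 1].getD i 0)
    (fun i => [{1}, {0, 2, 3, 4}, {1}, {1}, {1}].getD i ∅)
    ⟨0, by simp⟩ ?_ ?_ ?_ ?_ ?_
  · intro i hi j hj hij
    simp only [Finset.coe_range, Set.mem_Iio] at hi hj
    have h1 := hp.injective.eq_iff (a := 0) (b := 1)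
    have h2 := hp.injective.eq_iff (a := 0) (b := 2)
    have h3 := hp.injective.eq_iff (a := 1) (b := 2)
    have h4 := (hw 0).symm
    have h5 := (hw 2).symm
    have h6 := (hy 0).symm
    have h7 := (hy 2).symm
    interval_cases i <;> interval_cases j <;> simp_all
  · intro i hi
    simp only [Finset.mem_range] at hi
    interval_cases i <;> simp
  · decide
  · intro i hi
    simp only [Finset.mem_range] at hi
    interval_cases i <;> simp [hp.adj_iff hG, hadj, hadj.symm, hyadj, hyadj.symm]
  · intro i hi
    simp only [Finset.mem_range] at hi
    interval_cases i <;> norm_num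

end IsRay

theorem SimpleGraph.Connected.mem_of_forall_adj {V : Type*} {G : SimpleGraph V}
    (hG : G.Connected) {S : Set V} {a : V} (ha : a ∈ S)
    (hS : ∀ u ∈ S, ∀ v, G.Adj u v → v ∈ S) (b : V) : b ∈ S := by
  obtain ⟨q⟩ := hG.preconnected a b
  induction q with
  | nil => exact ha
  | cons h _ ih => exact ih (hS _ ha _ h)

/-- An infinite locally finite connected graph contains a ray. -/
theorem exists_isRay {V : Type*} [Infinite V] {G : SimpleGraph V} (hG : G.Connected)
    (hfin : ∀ v, (G.neighborSet v).Finite) : ∃ p, IsRay G p := by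
  obtain ⟨o⟩ := hG.nonempty
  let B : V → Set V := fun u => {w | G.dist o w = G.dist o u + G.dist u w}
  have step : ∀ u : {u // (B u).Infinite}, ∃ u' : {u // (B u).Infinite},
      G.Adj u u' ∧ G.dist o u' = G.dist o u + 1 := by
    rintro ⟨u, hu⟩
    by_contra! hno
    have hsub : B u ⊆ {u} ∪ ⋃ v ∈ {v | G.Adj u v ∧ G.dist o v = G.dist o u + 1}, B v := by
      intro w hw
      rcases eq_or_ne u w with rfl | hne
      · exact Or.inl rfl
      right
      obtain ⟨q, hq⟩ := hG.exists_walk_length_eq_dist u w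
      cases q with
      | nil => exact absurd rfl hne
      | @cons _ v _ h q =>
        have h1 := SimpleGraph.dist_le q
        have h2 := hG.dist_triangle (u := o) (v := v) (w := w)
        have h3 := hG.dist_triangle (u := o) (v := u) (w := v)
        have h4 := SimpleGraph.dist_eq_one_iff_adj.2 h
        simp only [SimpleGraph.Walk.length_cons] at hq
        simp only [B, Set.mem_ofPred_eq] at hw
        simp only [Set.mem_iUnion, Set.mem_ofPred_eq, B]
        exact ⟨v, ⟨h, by omega⟩, by omega⟩
    refine hu (Set.Finite.subset ((Set.finite_singleton u).union
      (Set.Finite.biUnion ((hfin u).subset fun v hv => hv.1) ?_)) hsub)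
    intro v hv
    by_contra hinf
    exact hno ⟨v, hinf⟩ hv.1 hv.2
  choose f hf using step
  have ho : (B o).Infinite := by
    have : B o = Set.univ := by ext w; simp [B]
    rw [this]
    exact Set.infinite_univ
  let q : ℕ → {u // (B u).Infinite} := fun n => f^[n] ⟨o, ho⟩
  have hq : ∀ n, q (n + 1) = f (q n) := fun n => Function.iterate_succ_apply' f n _
  have hd : ∀ n, G.dist o (q n) = n := by
    intro n
    induction n with
    | zero => simp [q]
    | succ n ih => rw [hq, (hf _).2, ih]
  refine ⟨fun n => q n, fun m n h => ?_, fun n => ?_⟩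
  · rw [← hd m, ← hd n]
    exact congrArg _ h
  · simp only [hq]
    exact (hf _).1

theorem rayGraph_adj {m n : ℕ} : rayGraph.Adj m n ↔ n = m + 1 ∨ m = n + 1 := by
  simp only [rayGraph, SimpleGraph.fromRel_adj]
  omega

theorem lineGraph_adj {m n : ℤ} : lineGraph.Adj m n ↔ n = m + 1 ∨ m = n + 1 := by
  simp only [lineGraph, SimpleGraph.fromRel_adj]
  omega

theorem SimpleGraph.nonempty_iso_of_bijective {V W : Type*} {G : SimpleGraph V}
    {H : SimpleGraph W} {f : W → V} (hf : Function.Bijective f)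
    (h : ∀ a b, G.Adj (f a) (f b) ↔ H.Adj a b) : Nonempty (G ≃g H) :=
  ⟨SimpleGraph.Iso.symm ⟨Equiv.ofBijective f hf, fun {a b} => h a b⟩⟩

section Classification

variable {V : Type*} {G : SimpleGraph V} {p : ℕ → V}

theorem IsRay.nonempty_iso_dInftyGraph (hconn : G.Connected) (hG : NoFiniteSubharmonic G)
    (hp : IsRay G p) {w : V} (hw : ∀ n, p n ≠ w) (hadj : G.Adj (p 1) w) :
    Nonempty (G ≃g dInftyGraph) := by
  have hleaf : ∀ u, G.Adj w u → u = p 1 := fun u hu => hp.eq_of_adj_branch hG hw hadj.symm hu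
  have hleaf₀ : ∀ u, G.Adj (p 0) u → u = p 1 := by
    intro u hu
    have hq : IsRay G (consSeq w fun n => p (n + 1)) :=
      (hp.shift 1).cons (fun n => hw _) hadj.symm
    refine hq.eq_of_adj_branch hG (w := p 0) ?_ (hp.adj 0) hu
    rintro (_ | n) h
    · exact hw 0 h.symm
    · exact absurd (hp.injective h) (by omega)
  refine SimpleGraph.nonempty_iso_of_bijective (f := fun o : Option ℕ => o.elim w p) ⟨?_, ?_⟩ ?_
  · rintro (_ | m) (_ | n) h
    · rfl
    · exact absurd h.symm (hw n)
    · exact absurd h (hw m)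
    · exact congrArg some (hp.injective h)
  · refine hconn.mem_of_forall_adj (S := Set.range fun o : Option ℕ => o.elim w p)
      ⟨none, rfl⟩ ?_
    rintro _ ⟨o, rfl⟩ v hv
    rcases o with _ | _ | _ | n
    · exact ⟨some 1, (hleaf v hv).symm⟩
    · exact ⟨some 1, (hleaf₀ v hv).symm⟩
    · by_cases h : ∃ n, p n = v
      · exact ⟨some h.choose, h.choose_spec⟩
      · push Not at h
        exact ⟨none, (hp.eq_of_adj_one hG hw hadj h hv).symm⟩
    · obtain ⟨m, hm⟩ := hp.exists_eq_of_adj hG (by omega) hv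
      exact ⟨some m, hm⟩
  · have hwp : ∀ n, G.Adj w (p n) ↔ n = 1 :=
      fun n => ⟨fun h => hp.injective (hleaf _ h), fun h => h ▸ hadj.symm⟩
    rintro (_ | m) (_ | n)
    · simp
    · simp [dInftyGraph, SimpleGraph.fromRel_adj, hwp]
    · simp [dInftyGraph, SimpleGraph.fromRel_adj, G.adj_comm _ w, hwp]
    · simp [dInftyGraph, SimpleGraph.fromRel_adj, hp.adj_iff hG]
      omega

theorem IsRay.nonempty_iso_rayGraph (hconn : G.Connected) (hG : NoFiniteSubharmonic G)
    (hp : IsRay G p) (h₀ : ∀ w, G.Adj (p 0) w → ∃ n, p n = w)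
    (h₁ : ∀ w, G.Adj (p 1) w → ∃ n, p n = w) : Nonempty (G ≃g rayGraph) := by
  refine SimpleGraph.nonempty_iso_of_bijective ⟨hp.injective, ?_⟩
    fun m n => (hp.adj_iff hG).trans rayGraph_adj.symm
  refine hconn.mem_of_forall_adj (S := Set.range p) ⟨0, rfl⟩ ?_
  rintro _ ⟨n, rfl⟩ v hv
  rcases n with _ | _ | n
  · exact h₀ v hv
  · exact h₁ v hv
  · exact hp.exists_eq_of_adj hG (by omega) hv

theorem nonempty_iso_lineGraph (hconn : G.Connected) (hG : NoFiniteSubharmonic G)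
    (hp : IsRay G p) (hext : ∀ q, IsRay G q → ∃ w, IsRay G (consSeq w q)) :
    Nonempty (G ≃g lineGraph) := by
  choose w hw using fun q : {q // IsRay G q} => hext q q.2
  let s : {q // IsRay G q} → {q // IsRay G q} := fun q => ⟨consSeq (w q) q, hw q⟩
  let r : ℕ → ℕ → V := fun k => (s^[k] ⟨p, hp⟩).1
  have hr : ∀ k, IsRay G (r k) := fun k => (s^[k] ⟨p, hp⟩).2
  have hs : ∀ k n, r (k + 1) (n + 1) = r k n := by
    intro k n
    simp only [r, Function.iterate_succ_apply']
    rfl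
  have hs' : ∀ j k n, r (k + j) (n + j) = r k n := by
    intro j k n
    induction j with
    | zero => rfl
    | succ j ih => rw [← add_assoc, ← add_assoc, hs, ih]
  let f : ℤ → V := fun m => r m.natAbs (m + m.natAbs).toNat
  have hf : ∀ (m : ℤ) (k : ℕ), m.natAbs ≤ k → f m = r k (m + k).toNat := by
    intro m k hk
    exact (hs' (k - m.natAbs) _ _).symm.trans (congrArg₂ r (by omega) (by omega))
  refine SimpleGraph.nonempty_iso_of_bijective (f := f) ⟨?_, ?_⟩ ?_
  · intro m n h
    rw [hf m (m.natAbs + n.natAbs) (by omega), hf n (m.natAbs + n.natAbs) (by omega)] at h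
    have := (hr _).injective h
    omega
  · refine hconn.mem_of_forall_adj (S := Set.range f) ⟨0, rfl⟩ ?_
    rintro _ ⟨m, rfl⟩ v hv
    rw [hf m (m.natAbs + 2) (by omega)] at hv
    obtain ⟨n, rfl⟩ := (hr _).exists_eq_of_adj hG (by omega) hv
    refine ⟨n - (m.natAbs + 2 : ℕ), ?_⟩
    rw [hf _ (m.natAbs + 2 + n) (by omega), ← hs' n (m.natAbs + 2) n]
    exact congrArg₂ r (by omega) (by omega)
  · intro m n
    rw [hf m (m.natAbs + n.natAbs) (by omega), hf n (m.natAbs + n.natAbs) (by omega),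
      (hr _).adj_iff hG, lineGraph_adj]
    omega

theorem nonempty_iso_of_noFiniteSubharmonic (hconn : G.Connected)
    (hG : NoFiniteSubharmonic G) (hp : IsRay G p) :
    Nonempty (G ≃g rayGraph) ∨ Nonempty (G ≃g dInftyGraph) ∨ Nonempty (G ≃g lineGraph) := by
  by_cases hD : ∃ q, IsRay G q ∧ ∃ w, G.Adj (q 1) w ∧ ∀ n, q n ≠ w
  · obtain ⟨q, hq, w, hadj, hw⟩ := hD
    exact Or.inr (Or.inl (hq.nonempty_iso_dInftyGraph hconn hG hw hadj))
  by_cases hR : ∃ q, IsRay G q ∧ ∀ w, G.Adj (q 0) w → ∃ n, q n = w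
  · obtain ⟨q, hq, h⟩ := hR
    push Not at hD
    exact Or.inl (hq.nonempty_iso_rayGraph hconn hG h (hD q hq))
  · push Not at hR
    refine Or.inr (Or.inr (nonempty_iso_lineGraph hconn hG hp fun q hq => ?_))
    obtain ⟨w, hadj, hw⟩ := hR q hq
    exact ⟨w, hq.cons hw hadj.symm⟩

end Classification

section AdjacencyOperator

open Complex

variable {V : Type*} {G : SimpleGraph V}

/-- The standard basis vector of `ℓ²(V, ℂ)` at the vertex `v`. -/
def vertexVec (v : V) : lp (fun _ : V => ℂ) 2 := by
  classical exact lp.single 2 v 1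

open Classical in
theorem vertexVec_apply (v w : V) : vertexVec v w = if w = v then 1 else 0 := by
  simp [vertexVec, Pi.single_apply]

theorem inner_vertexVec_left (v : V) (ξ : lp (fun _ : V => ℂ) 2) :
    inner ℂ (vertexVec v) ξ = ξ v := by
  classical
  rw [vertexVec, lp.inner_single_left]
  simp

theorem orthonormal_vertexVec : Orthonormal ℂ (vertexVec : V → lp (fun _ : V => ℂ) 2) := by
  classical
  rw [orthonormal_iff_ite]
  intro i j
  rw [inner_vertexVec_left, vertexVec_apply]

theorem lp_sum_apply {ι : Type*} (s : Finset ι) (g : ι → lp (fun _ : V => ℂ) 2) (v : V) :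
    (∑ i ∈ s, g i : lp (fun _ : V => ℂ) 2) v = ∑ i ∈ s, g i v := by
  simp only [← inner_vertexVec_left v, inner_sum]

/-- `A` acts on `ℓ²(V, ℂ)` as the adjacency operator of `G`. -/
def IsAdjacencyOperator (G : SimpleGraph V)
    (A : lp (fun _ : V => ℂ) 2 →L[ℂ] lp (fun _ : V => ℂ) 2) : Prop :=
  ∀ (ξ : lp (fun _ : V => ℂ) 2) (v : V), A ξ v = ∑ᶠ w ∈ G.neighborSet v, ξ w

namespace IsAdjacencyOperator

variable {A : lp (fun _ : V => ℂ) 2 →L[ℂ] lp (fun _ : V => ℂ) 2}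

open Classical in
theorem apply_vertexVec (hA : IsAdjacencyOperator G A) (u v : V) :
    A (vertexVec u) v = if G.Adj v u then 1 else 0 := by
  rw [hA]
  simp only [vertexVec_apply, SimpleGraph.mem_neighborSet]
  rw [finsum_eq_single _ u]
  · simp [finsum_eq_if]
  · intro w hw
    simp [hw]

theorem isSelfAdjoint (hA : IsAdjacencyOperator G A) (hfin : ∀ v, (G.neighborSet v).Finite) :
    IsSelfAdjoint A := by
  classical
  have hvec : ∀ v, A (vertexVec v) = ∑ w ∈ (hfin v).toFinset, vertexVec w := by
    intro v
    ext u
    rw [lp_sum_apply]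
    simp [hA.apply_vertexVec, vertexVec_apply, G.adj_comm]
  rw [ContinuousLinearMap.isSelfAdjoint_iff']
  ext ξ v
  rw [← inner_vertexVec_left v, ContinuousLinearMap.adjoint_inner_right, hvec, sum_inner, hA]
  simp only [inner_vertexVec_left]
  rw [finsum_mem_eq_finite_toFinset_sum _ (hfin v)]

theorem noFiniteSubharmonic [Infinite V] (hconn : G.Connected) (hA : IsAdjacencyOperator G A)
    (hnorm : ‖A‖ ≤ 2) : NoFiniteSubharmonic G := by
  classical
  intro S x c N hS hx hc hNS hN hsub
  set f : lp (fun _ : V => ℂ) 2 := ∑ i ∈ S, (c i : ℂ) • vertexVec (x i) with hf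
  have hinner : ∀ g, inner ℂ f g = ∑ i ∈ S, (c i : ℂ) * g (x i) := by
    intro g
    rw [hf, sum_inner]
    refine Finset.sum_congr rfl fun i _ => ?_
    rw [inner_smul_left, inner_vertexVec_left, conj_ofReal]
  have hfv : ∀ v, f v = ∑ i ∈ S, if v = x i then (c i : ℂ) else 0 := by
    intro v
    rw [hf, lp_sum_apply]
    refine Finset.sum_congr rfl fun i _ => ?_
    rw [lp.coeFn_smul, Pi.smul_apply, vertexVec_apply, smul_eq_mul, mul_ite, mul_one, mul_zero]
  have hfx : ∀ i ∈ S, f (x i) = c i := by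
    intro i hi
    rw [hfv, Finset.sum_eq_single_of_mem i hi]
    · simp
    · intro j hj hji
      rw [if_neg]
      exact fun h => hji (hx hj hi h.symm)
  have hAf : ∀ v, A f v = ((∑ i ∈ S, if G.Adj v (x i) then c i else 0 : ℝ) : ℂ) := by
    intro v
    rw [hf, map_sum, lp_sum_apply]
    simp [hA.apply_vertexVec, apply_ite]
  have hff : ‖f‖ ^ 2 = ∑ i ∈ S, c i * c i := by
    have h : ((‖f‖ ^ 2 : ℝ) : ℂ) = ((∑ i ∈ S, c i * c i : ℝ) : ℂ) := by
      push_cast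
      refine (inner_self_eq_norm_sq_to_K (𝕜 := ℂ) f).symm.trans ?_
      rw [hinner]
      exact Finset.sum_congr rfl fun i hi => by rw [hfx i hi]
    exact_mod_cast h
  have hAff : 2 * ‖f‖ ^ 2 ≤ (inner ℂ f (A f)).re := by
    rw [hinner, hff, Finset.mul_sum]
    simp only [hAf, ← ofReal_mul, ← ofReal_sum, ofReal_re]
    refine Finset.sum_le_sum fun i hi => ?_
    rw [mul_left_comm]
    refine mul_le_mul_of_nonneg_left ((hsub i hi).trans ?_) (hc i hi).le
    rw [← Finset.sum_filter]
    refine Finset.sum_le_sum_of_subset_of_nonneg (fun j hj => ?_) fun j hj _ => ?_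
    · exact Finset.mem_filter.2 ⟨hNS i hi hj, hN i hi j hj⟩
    · exact (hc j (Finset.mem_filter.1 hj).1).le
  have heq : A f = (2 : ℂ) • f := by
    have h1 : ‖A f‖ ≤ 2 * ‖f‖ := A.le_of_opNorm_le hnorm f
    have h2 : ‖A f - (2 : ℂ) • f‖ ^ 2 = ‖A f‖ ^ 2 - 4 * (inner ℂ f (A f)).re + 4 * ‖f‖ ^ 2 := by
      have hsymm : (inner ℂ (A f) f).re = (inner ℂ f (A f)).re := inner_re_symm (𝕜 := ℂ) _ _
      rw [@norm_sub_sq ℂ, inner_smul_right, norm_smul]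
      simp [hsymm]
      ring
    have h3 : ‖A f - (2 : ℂ) • f‖ ^ 2 ≤ 0 := by
      nlinarith [norm_nonneg (A f), norm_nonneg f]
    have h4 : ‖A f - (2 : ℂ) • f‖ = 0 := by
      nlinarith [norm_nonneg (A f - (2 : ℂ) • f)]
    exact sub_eq_zero.1 (norm_eq_zero.1 h4)
  obtain ⟨v, hv⟩ := (S.image x).exists_notMem
  obtain ⟨i₀, hi₀⟩ := hS
  refine hv (Finset.mem_coe.1 (hconn.mem_of_forall_adj
    (Finset.mem_coe.2 (Finset.mem_image_of_mem x hi₀)) ?_ v))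
  intro u hu w huw
  by_contra hw
  obtain ⟨i, hi, rfl⟩ := Finset.mem_image.1 (Finset.mem_coe.1 hu)
  have hpos : 0 < ∑ j ∈ S, if G.Adj w (x j) then c j else 0 := by
    refine Finset.sum_pos' (fun j hj => ?_) ⟨i, hi, ?_⟩
    · split_ifs
      · exact (hc j hj).le
      · exact le_rfl
    · rw [if_pos huw.symm]
      exact hc i hi
  have hzero : A f w = 0 := by
    rw [heq, lp.coeFn_smul, Pi.smul_apply, hfv, Finset.sum_eq_zero, smul_zero]
    intro j hj
    rw [if_neg]
    rintro rfl
    exact hw (Finset.mem_coe.2 (Finset.mem_image_of_mem x hj))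
  rw [hAf, ofReal_eq_zero] at hzero
  exact hpos.ne' hzero

theorem apply_vertexVec_ray (hA : IsAdjacencyOperator G A) (hG : NoFiniteSubharmonic G)
    {p : ℕ → V} (hp : IsRay G p) (n : ℕ) :
    A (vertexVec (p (n + 2))) = vertexVec (p (n + 1)) + vertexVec (p (n + 3)) := by
  classical
  ext v
  rw [hA.apply_vertexVec, lp.coeFn_add, Pi.add_apply, vertexVec_apply, vertexVec_apply]
  by_cases hv : ∃ m, p m = v
  · obtain ⟨m, rfl⟩ := hv
    simp only [hp.adj_iff hG, hp.injective.eq_iff]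
    split_ifs <;> first | omega | simp
  · rw [if_neg, if_neg, if_neg, add_zero]
    · rintro rfl; exact hv ⟨_, rfl⟩
    · rintro rfl; exact hv ⟨_, rfl⟩
    · exact fun h => hv (hp.exists_eq_of_adj hG (by omega) h.symm)

/-- Every `z + z⁻¹` with `|z| = 1` is an approximate eigenvalue of `A`, with truncations of the
plane wave `n ↦ z ^ n` along a ray as approximate eigenvectors. -/
theorem add_inv_mem_spectrum (hA : IsAdjacencyOperator G A) (hG : NoFiniteSubharmonic G)
    {p : ℕ → V} (hp : IsRay G p) {z : ℂ} (hz : ‖z‖ = 1) : z + z⁻¹ ∈ spectrum ℂ A := by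
  have hz0 : z ≠ 0 := norm_ne_zero_iff.1 (by rw [hz]; exact one_ne_zero)
  let e : ℕ → lp (fun _ : V => ℂ) 2 := fun n => vertexVec (p n)
  have he : Orthonormal ℂ e := orthonormal_vertexVec.comp p hp.injective
  let ξ : ℕ → lp (fun _ : V => ℂ) 2 := fun N => ∑ n ∈ Finset.range N, z ^ (n + 1) • e (n + 2)
  let C : ℕ → lp (fun _ : V => ℂ) 2 := fun n => z ^ n • e (n + 2) - z ^ (n + 1) • e (n + 1)
  have hξ : ∀ N, ‖ξ N‖ ^ 2 = N := by
    intro N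
    have he' : Orthonormal ℂ fun n => e (n + 2) := he.comp _ (add_left_injective 2)
    have h : ((‖ξ N‖ ^ 2 : ℝ) : ℂ) = (N : ℝ) := by
      push_cast
      refine (inner_self_eq_norm_sq_to_K (𝕜 := ℂ) (ξ N)).symm.trans ?_
      rw [he'.inner_sum]
      simp [← mul_pow, ← normSq_eq_conj_mul_self, normSq_eq_norm_sq, hz]
    exact_mod_cast h
  have hC : ∀ n, ‖C n‖ ≤ 2 := by
    intro n
    refine (norm_sub_le _ _).trans ?_
    rw [norm_smul, norm_smul, he.1, he.1, norm_pow, norm_pow, hz]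
    norm_num
  have hAξ : ∀ N, ((z + z⁻¹) • ξ N - A (ξ N)) = C 0 - C N := by
    intro N
    rw [← Finset.sum_range_sub' C N]
    simp only [ξ, map_sum, map_smul, Finset.smul_sum, ← Finset.sum_sub_distrib]
    refine Finset.sum_congr rfl fun n _ => ?_
    rw [show A (e (n + 2)) = e (n + 1) + e (n + 3) from hA.apply_vertexVec_ray hG hp n]
    have h1 : (z + z⁻¹) * z ^ (n + 1) = z ^ (n + 2) + z ^ n := by
      rw [add_mul, ← pow_succ', pow_succ' z n, inv_mul_cancel_left₀ hz0]
    simp only [C, smul_smul, h1]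
    module
  rw [spectrum.mem_iff]
  rintro ⟨u, hu⟩
  have hinv : ∀ N, ξ N = (↑u⁻¹ : lp (fun _ : V => ℂ) 2 →L[ℂ] lp (fun _ : V => ℂ) 2)
      (C 0 - C N) := by
    intro N
    rw [← hAξ]
    have h2 := congrArg (fun T : lp (fun _ : V => ℂ) 2 →L[ℂ] lp (fun _ : V => ℂ) 2 => T (ξ N))
      u.inv_mul
    simp only [mul_apply_eq_comp, hu, one_apply_eq_self] at h2
    conv_lhs => rw [← h2]
    simp [Algebra.algebraMap_eq_smul_one]
  set T : lp (fun _ : V => ℂ) 2 →L[ℂ] lp (fun _ : V => ℂ) 2 := ↑u⁻¹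
  have hle : ∀ N, ‖ξ N‖ ≤ ‖T‖ * 4 := by
    intro N
    rw [hinv N]
    refine T.le_opNorm_of_le ((norm_sub_le _ _).trans ?_)
    linarith [hC 0, hC N]
  obtain ⟨N, hN⟩ := exists_nat_gt ((‖T‖ * 4) ^ 2)
  have := pow_le_pow_left₀ (norm_nonneg _) (hle N) 2
  rw [hξ] at this
  linarith

theorem ofReal_mem_spectrum (hA : IsAdjacencyOperator G A) (hG : NoFiniteSubharmonic G)
    {p : ℕ → V} (hp : IsRay G p) {t : ℝ} (ht : t ∈ Set.Icc (-2 : ℝ) 2) :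
    (t : ℂ) ∈ spectrum ℂ A := by
  have h := hA.add_inv_mem_spectrum hG hp (norm_exp_ofReal_mul_I (Real.arccos (t / 2)))
  rw [← exp_neg, ← neg_mul, ← two_cos, ← ofReal_cos,
    Real.cos_arccos (by linarith [ht.1]) (by linarith [ht.2])] at h
  convert h using 1
  push_cast
  ring

theorem norm_eq_two (hA : IsAdjacencyOperator G A) (hG : NoFiniteSubharmonic G)
    {p : ℕ → V} (hp : IsRay G p) (hnorm : ‖A‖ ≤ 2) : ‖A‖ = 2 := by
  refine le_antisymm hnorm ?_
  have : Nontrivial (lp (fun _ : V => ℂ) 2) :=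
    ⟨⟨vertexVec (p 0), 0, orthonormal_vertexVec.ne_zero _⟩⟩
  have h := spectrum.norm_le_norm_of_mem
    (hA.ofReal_mem_spectrum hG hp (t := 2) (by norm_num))
  simpa using h

theorem spectrum_eq (hA : IsAdjacencyOperator G A) (hG : NoFiniteSubharmonic G)
    (hfin : ∀ v, (G.neighborSet v).Finite) {p : ℕ → V} (hp : IsRay G p) (hnorm : ‖A‖ ≤ 2) :
    spectrum ℂ A = ofReal '' Set.Icc (-2 : ℝ) 2 := by
  have : Nontrivial (lp (fun _ : V => ℂ) 2) :=
    ⟨⟨vertexVec (p 0), 0, orthonormal_vertexVec.ne_zero _⟩⟩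
  ext w
  constructor
  · intro hw
    have hre := (hA.isSelfAdjoint hfin).mem_spectrum_eq_re hw
    refine ⟨w.re, ?_, hre.symm⟩
    exact abs_le.1 ((abs_re_le_norm w).trans ((spectrum.norm_le_norm_of_mem hw).trans hnorm))
  · rintro ⟨t, ht, rfl⟩
    exact hA.ofReal_mem_spectrum hG hp ht

end IsAdjacencyOperator

end AdjacencyOperator

/-- An infinite connected graph of bounded degree whose adjacency operator has norm at most
`2` in fact has norm exactly `2`, spectrum `[-2, 2]`, and is isomorphic to the infinite ray,
to `D_∞`, or to the infinite line. -/
theorem stmt_14 {V : Type} [Countable V] [Infinite V] (G : SimpleGraph V)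
    (hconn : G.Connected)
    (hfin : ∀ v, (G.neighborSet v).Finite)
    (hbdd : ∃ D : ℕ, ∀ v, (G.neighborSet v).ncard ≤ D)
    (A : lp (fun _ : V => ℂ) 2 →L[ℂ] lp (fun _ : V => ℂ) 2)
    (hA : ∀ (ξ : lp (fun _ : V => ℂ) 2) (v : V), A ξ v = ∑ᶠ w ∈ G.neighborSet v, ξ w)
    (hnorm : ‖A‖ ≤ 2) :
    ‖A‖ = 2 ∧ spectrum ℂ A = Complex.ofReal '' Set.Icc (-2 : ℝ) 2 ∧
      (Nonempty (G ≃g rayGraph) ∨ Nonempty (G ≃g dInftyGraph) ∨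
        Nonempty (G ≃g lineGraph)) := by
  have hA' : IsAdjacencyOperator G A := hA
  have hG := hA'.noFiniteSubharmonic hconn hnorm
  obtain ⟨p, hp⟩ := exists_isRay hconn hfin
  exact ⟨hA'.norm_eq_two hG hp hnorm, hA'.spectrum_eq hG hfin hp hnorm,
    nonempty_iso_of_noFiniteSubharmonic hconn hG hp⟩
end
end

section
/- The infinite ray is determined by its marked spectrum: if G is a simple graph on a countable vertex set with uniformly bounded vertex degrees whose adjacency operator A_G is unitarily equivalent to the adjacency operator A_R of the infinite ray, then G is isomorphic (as a simple graph) to the infinite ray R. -/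
noncomputable section

section RayOperator

open Filter Topology

variable {AR : lp (fun _ : ℕ => ℂ) 2 →L[ℂ] lp (fun _ : ℕ => ℂ) 2}

theorem tendsto_coord (x : lp (fun _ : ℕ => ℂ) 2) : Tendsto (fun n => x n) atTop (𝓝 0) := by
  have h := (lp.memℓp x).summable (by norm_num)
  have h1 := h.tendsto_atTop_zero
  rw [tendsto_zero_iff_norm_tendsto_zero]
  have h2 := h1.sqrt
  simp at h2
  exact h2

/-- The adjacency operator of the infinite ray has no eigenvectors: along a solution of
`ξ (n + 2) = μ ξ (n + 1) - ξ n` the quadratic form `ξ (n + 1) ^ 2 - μ ξ n ξ (n + 1) + ξ n ^ 2` is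
constant. -/
theorem ray_no_eigenvector
    (hAR : ∀ (ξ : lp (fun _ : ℕ => ℂ) 2) (n : ℕ),
      AR ξ n = (if n = 0 then 0 else ξ (n - 1)) + ξ (n + 1))
    {μ : ℂ} {x : lp (fun _ : ℕ => ℂ) 2} (hx : AR x = μ • x) : x = 0 := by
  have hrec : ∀ n, x n + x (n + 2) = μ * x (n + 1) := fun n => by
    have := hAR x (n + 1)
    simp [hx] at this
    exact this.symm
  have h1 : x 1 = μ * x 0 := by
    have := hAR x 0
    simp [hx] at this
    exact this.symm
  have hQ : ∀ n, x (n + 1) ^ 2 - μ * x n * x (n + 1) + x n ^ 2 = x 0 ^ 2 := by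
    intro n
    induction n with
    | zero => rw [zero_add, h1]; ring
    | succ n ih =>
      rw [← ih]
      linear_combination (x (n + 2) - x n) * hrec n
  have ht := tendsto_coord x
  have ht1 := (tendsto_add_atTop_iff_nat 1).2 ht
  have h0 := ((ht1.pow 2).sub ((ht.const_mul μ).mul ht1)).add (ht.pow 2)
  simp only [hQ] at h0
  have h00 : x 0 = 0 := by simpa using tendsto_nhds_unique tendsto_const_nhds h0
  have key : ∀ n, x n = 0 ∧ x (n + 1) = 0 := by
    intro n
    induction n with
    | zero => simp [h1, h00]
    | succ n ih =>
      refine ⟨ih.2, ?_⟩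
      have := hrec n
      rw [ih.1, ih.2] at this
      simpa using this
  ext n
  simpa using (key n).1

theorem ray_norm_le
    (hAR : ∀ (ξ : lp (fun _ : ℕ => ℂ) 2) (n : ℕ),
      AR ξ n = (if n = 0 then 0 else ξ (n - 1)) + ξ (n + 1))
    (x : lp (fun _ : ℕ => ℂ) 2) : ‖AR x‖ ^ 2 ≤ 4 * ‖x‖ ^ 2 := by
  have hs : ∀ y : lp (fun _ : ℕ => ℂ) 2, HasSum (fun n => ‖y n‖ ^ 2) (‖y‖ ^ 2) := fun y => by
    simpa using lp.hasSum_norm (p := 2) (by norm_num) y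
  have h1 : HasSum (fun n => ‖x (n + 1)‖ ^ 2) (‖x‖ ^ 2 - ‖x 0‖ ^ 2) := by
    simpa using (hasSum_nat_add_iff' 1).2 (hs x)
  have h2 : HasSum (fun n => ‖(if n = 0 then 0 else x (n - 1) : ℂ)‖ ^ 2) (‖x‖ ^ 2) := by
    rw [← hasSum_nat_add_iff' 1]
    simpa using hs x
  have := hasSum_le (fun n => ?_) (hs (AR x)) ((h1.add h2).mul_left 2)
  · nlinarith [sq_nonneg ‖x 0‖]
  · rw [hAR]
    set a : ℂ := if n = 0 then 0 else x (n - 1)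
    have := norm_add_le a (x (n + 1))
    nlinarith [sq_nonneg (‖a‖ - ‖x (n + 1)‖), norm_nonneg (a + x (n + 1))]

/-- The quadratic form of the infinite ray is strictly below `2`. -/
theorem ray_inner_lt
    (hAR : ∀ (ξ : lp (fun _ : ℕ => ℂ) 2) (n : ℕ),
      AR ξ n = (if n = 0 then 0 else ξ (n - 1)) + ξ (n + 1))
    {x : lp (fun _ : ℕ => ℂ) 2} (hx : x ≠ 0) : (inner ℂ x (AR x)).re < 2 * ‖x‖ ^ 2 := by
  by_contra! h
  refine hx (ray_no_eigenvector hAR (μ := 2) ?_)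
  rw [← sub_eq_zero, ← norm_eq_zero, ← sq_eq_zero_iff]
  have h1 := norm_sub_sq (𝕜 := ℂ) (AR x) ((2 : ℂ) • x)
  rw [inner_smul_right, norm_smul] at h1
  have h2 : (inner ℂ (AR x) x).re = (inner ℂ x (AR x)).re := by
    exact inner_re_symm (𝕜 := ℂ) _ _
  have h3 : RCLike.re ((2 : ℂ) * inner ℂ (AR x) x) = 2 * (inner ℂ x (AR x)).re := by
    rw [← h2]; simp
  rw [h3] at h1
  have h4 := ray_norm_le hAR x
  norm_num at h1
  nlinarith [sq_nonneg ‖AR x - (2 : ℂ) • x‖]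

/-- If `f` satisfies the recurrence of the orbit of the endpoint, its matrix is symmetric, since it
solves a discrete wave equation that is invariant under transposition. -/
theorem ray_symm
    (hAR : ∀ (ξ : lp (fun _ : ℕ => ℂ) 2) (n : ℕ),
      AR ξ n = (if n = 0 then 0 else ξ (n - 1)) + ξ (n + 1))
    {f : ℕ → lp (fun _ : ℕ => ℂ) 2} (h0 : AR (f 0) = f 1)
    (hf : ∀ n, AR (f (n + 1)) = f n + f (n + 2)) (m n : ℕ) : f m n = f n m := by
  have hw : ∀ m n, (if m = 0 then 0 else f (m - 1) n) + f (m + 1) n =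
      (if n = 0 then 0 else f m (n - 1)) + f m (n + 1) := fun m n => by
    rw [← hAR]
    cases m with
    | zero => simp [h0]
    | succ m => simp [hf]
  suffices H : ∀ s, ∀ m n, m + n = s → f m n = f n m from H _ m n rfl
  intro s
  induction s using Nat.strong_induction_on with
  | _ s ih =>
    have step : ∀ m n, m + n + 1 = s → f (m + 1) n - f n (m + 1) = f m (n + 1) - f (n + 1) m := by
      intro m n h
      have a := hw m n
      have b := hw n m
      have c : (if m = 0 then 0 else f (m - 1) n) = (if m = 0 then 0 else f n (m - 1)) := by
        split_ifs with hm
        · rfl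
        · exact ih _ (by omega) _ _ rfl
      have d : (if n = 0 then 0 else f m (n - 1)) = (if n = 0 then 0 else f (n - 1) m) := by
        split_ifs with hm
        · rfl
        · exact ih _ (by omega) _ _ rfl
      rw [c] at a
      rw [← d] at b
      linear_combination a + b
    have const : ∀ m n, m + n = s → f m n - f n m = f 0 s - f s 0 := by
      intro m
      induction m with
      | zero => intro n h; rw [zero_add] at h; rw [h]
      | succ m ihm => intro n h; rw [step m n (by omega), ihm (n + 1) (by omega)]
    intro m n h
    have a := const m n h
    have b := const n m (by omega)
    linear_combination (a - b) / 2

/-- An orthonormal sequence that satisfies the recurrence of the standard basis under the adjacency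
operator of the ray is complete. This is the form in which multiplicity one is used. -/
theorem ray_complete
    (hAR : ∀ (ξ : lp (fun _ : ℕ => ℂ) 2) (n : ℕ),
      AR ξ n = (if n = 0 then 0 else ξ (n - 1)) + ξ (n + 1))
    {f : ℕ → lp (fun _ : ℕ => ℂ) 2} (ho : Orthonormal ℂ f) (h0 : AR (f 0) = f 1)
    (hf : ∀ n, AR (f (n + 1)) = f n + f (n + 2)) {g : lp (fun _ : ℕ => ℂ) 2}
    (hg : ∀ n, inner ℂ (f n) g = 0) : g = 0 := by
  by_contra hne
  refine hne ?_
  ext m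
  have hs : HasSum (fun n => ‖f n m‖ ^ 2) 1 := by
    have := lp.hasSum_norm (p := 2) (by norm_num) (f m)
    simp only [ray_symm hAR h0 hf m] at this
    simpa [ho.1 m] using this
  set e : lp (fun _ : ℕ => ℂ) 2 := lp.single 2 m 1 with he
  have hfe : ∀ n, ‖inner ℂ (f n) e‖ = ‖f n m‖ := fun n => by
    rw [lp.inner_single_right]; simp
  have hge : ‖inner ℂ g e‖ = ‖g m‖ := by rw [lp.inner_single_right]; simp
  have hen : ‖e‖ = 1 := by rw [he, lp.norm_single (by norm_num)]; simp
  set x := ((‖g‖ ^ 2 : ℝ) : ℂ) • e - (inner ℂ g e) • g with hx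
  have hb := ho.tsum_inner_products_le x
  have h1 : ∀ n, ‖inner ℂ (f n) x‖ ^ 2 = ‖g‖ ^ 4 * ‖f n m‖ ^ 2 := fun n => by
    rw [hx, inner_sub_right, inner_smul_right, inner_smul_right, hg, mul_zero, sub_zero,
      norm_mul, hfe, Complex.norm_real, norm_pow, norm_norm]
    ring
  simp only [h1] at hb
  rw [(hs.mul_left _).tsum_eq] at hb
  have h2 := norm_sub_sq (𝕜 := ℂ) (((‖g‖ ^ 2 : ℝ) : ℂ) • e) ((inner ℂ g e) • g)
  have h3 : RCLike.re (inner ℂ (((‖g‖ ^ 2 : ℝ) : ℂ) • e) ((inner ℂ g e) • g))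
      = ‖g‖ ^ 2 * ‖g m‖ ^ 2 := by
    rw [inner_smul_left, inner_smul_right, ← inner_conj_symm e g, Complex.mul_conj, ← hge,
      Complex.normSq_eq_norm_sq, Complex.conj_ofReal, ← Complex.ofReal_mul]
    rfl
  rw [← hx, h3, norm_smul, norm_smul, hge, hen, Complex.norm_real, norm_pow, norm_norm] at h2
  have hg0 : 0 < ‖g‖ ^ 2 := by positivity
  have h4 : ‖g‖ ^ 2 * ‖g m‖ ^ 2 ≤ 0 := by nlinarith
  have h5 : ‖g m‖ ^ 2 ≤ 0 := by
    by_contra! h; nlinarith [mul_pos hg0 h]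
  simpa using le_antisymm h5 (sq_nonneg _)

end RayOperator

theorem SimpleGraph.exists_adj_dist_eq {V : Type*} {G : SimpleGraph V} {u v : V} {n : ℕ}
    (hr : G.Reachable u v) (hd : G.dist u v = n + 1) :
    ∃ w, G.Adj u w ∧ G.Reachable w v ∧ G.dist w v = n := by
  obtain ⟨p, hp⟩ := hr.exists_walk_length_eq_dist
  cases p with
  | nil => simp at hd
  | @cons _ w _ h q =>
    refine ⟨w, h, q.reachable, ?_⟩
    have h1 := G.dist_le q
    have h2 := h.reachable.dist_triangle_left v
    rw [SimpleGraph.dist_eq_one_iff_adj.2 h] at h2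
    simp at hp
    omega

theorem SimpleGraph.Adj.dist_le_succ {V : Type*} {G : SimpleGraph V} {u w v : V}
    (h : G.Adj u w) : G.dist u v ≤ G.dist w v + 1 := by
  have h2 := h.reachable.dist_triangle_left v
  rw [SimpleGraph.dist_eq_one_iff_adj.2 h] at h2
  omega

theorem SimpleGraph.finite_dist_le {V : Type*} {G : SimpleGraph V}
    (hfin : ∀ v, (G.neighborSet v).Finite) (v : V) (n : ℕ) :
    {u | G.Reachable u v ∧ G.dist u v ≤ n}.Finite := by
  induction n with
  | zero =>
    refine (Set.finite_singleton v).subset ?_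
    rintro u ⟨hr, hd⟩
    exact hr.dist_eq_zero_iff.1 (by omega)
  | succ n ih =>
    refine (ih.union (ih.biUnion fun w _ => hfin w)).subset ?_
    rintro u ⟨hr, hd⟩
    rcases Nat.lt_or_ge n (G.dist u v) with h | h
    · obtain ⟨w, hw, hwr, hwd⟩ := SimpleGraph.exists_adj_dist_eq hr (n := n) (by omega)
      exact Or.inr (Set.mem_biUnion (x := w) ⟨hwr, hwd.le⟩ hw.symm)
    · exact Or.inl ⟨hr, h⟩

theorem SimpleGraph.exists_dist_eq {V : Type*} {G : SimpleGraph V}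
    (hfin : ∀ v, (G.neighborSet v).Finite)
    (hinf : ∀ C : Set V, C.Finite → C.Nonempty → ¬ ∀ u ∈ C, ∀ w, G.Adj u w → w ∈ C)
    (v : V) (n : ℕ) : ∃ u, G.Reachable u v ∧ G.dist u v = n := by
  cases n with
  | zero => exact ⟨v, .rfl, by simp⟩
  | succ n =>
    by_contra! hc
    refine hinf _ (G.finite_dist_le hfin v n) ⟨v, .rfl, by simp⟩ ?_
    rintro u ⟨hr, hd⟩ w hw
    have h1 : G.Reachable w v := hw.symm.reachable.trans hr
    have h2 := hc w h1
    have h3 := hw.symm.dist_le_succ (v := v)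
    exact ⟨h1, by omega⟩

/-- A graph of maximal degree two without finite components that has a leaf contains an infinite ray
as a component. -/
theorem SimpleGraph.exists_ray {V : Type*} {G : SimpleGraph V}
    (hfin : ∀ v, (G.neighborSet v).Finite)
    (hinf : ∀ C : Set V, C.Finite → C.Nonempty → ¬ ∀ u ∈ C, ∀ w, G.Adj u w → w ∈ C)
    (hdeg : ∀ v a b c, G.Adj v a → G.Adj v b → G.Adj v c → a = b ∨ a = c ∨ b = c)
    {v : V} (hv : ∀ a b, G.Adj v a → G.Adj v b → a = b) :
    ∃ x : ℕ → V, Function.Injective x ∧ (∀ u, G.Adj (x 0) u ↔ u = x 1) ∧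
      ∀ n u, G.Adj (x (n + 1)) u ↔ u = x n ∨ u = x (n + 2) := by
  choose x hxr hxd using SimpleGraph.exists_dist_eq hfin hinf v
  have hx0 : x 0 = v := (hxr 0).dist_eq_zero_iff.1 (hxd 0)
  have huniq : ∀ n u, G.Reachable u v → G.dist u v = n → u = x n := by
    intro n
    induction n using Nat.strong_induction_on with
    | _ n ih =>
      intro u hr hd
      match n, ih, hd with
      | 0, _, hd => rw [hx0]; exact hr.dist_eq_zero_iff.1 hd
      | 1, ih, hd =>
        obtain ⟨w, hw, hwr, hwd⟩ := SimpleGraph.exists_adj_dist_eq hr hd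
        obtain ⟨w', hw', hwr', hwd'⟩ := SimpleGraph.exists_adj_dist_eq (hxr 1) (hxd 1)
        rw [ih 0 (by omega) w hwr hwd, hx0] at hw
        rw [ih 0 (by omega) w' hwr' hwd', hx0] at hw'
        exact hv _ _ hw.symm hw'.symm
      | n + 2, ih, hd =>
        obtain ⟨w, hw, hwr, hwd⟩ := SimpleGraph.exists_adj_dist_eq hr hd
        obtain ⟨w', hw', hwr', hwd'⟩ := SimpleGraph.exists_adj_dist_eq (hxr (n + 2)) (hxd (n + 2))
        obtain ⟨z, hz, hzr, hzd⟩ := SimpleGraph.exists_adj_dist_eq hwr hwd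
        rw [ih (n + 1) (by omega) w' hwr' hwd', ← ih (n + 1) (by omega) w hwr hwd] at hw'
        rcases hdeg w u (x (n + 2)) z hw.symm hw'.symm hz with h | h | h
        · exact h
        · rw [h] at hd; omega
        · rw [← h, hxd] at hzd; omega
  have hadj : ∀ n, G.Adj (x n) (x (n + 1)) := fun n => by
    obtain ⟨w, hw, hwr, hwd⟩ := SimpleGraph.exists_adj_dist_eq (hxr (n + 1)) (hxd (n + 1))
    rw [huniq n w hwr hwd] at hw
    exact hw.symm
  have hinj : Function.Injective x := fun m n h => by rw [← hxd m, ← hxd n, h]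
  refine ⟨x, hinj, fun u => ⟨fun h => ?_, ?_⟩, fun n u => ⟨fun h => ?_, ?_⟩⟩
  · have h1 := hadj 0
    rw [hx0] at h h1
    exact hv _ _ h h1
  · rintro rfl; exact hadj 0
  · rcases hdeg _ _ _ _ h (hadj n).symm (hadj (n + 1)) with h | h | h
    · exact Or.inl h
    · exact Or.inr h
    · have := hinj h; omega
  · rintro (rfl | rfl)
    · exact (hadj n).symm
    · exact hadj (n + 1)

/-- A two-regular graph without finite components contains a two-way infinite line as a component. -/
theorem SimpleGraph.exists_line {V : Type*} {G : SimpleGraph V}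
    (hinf : ∀ C : Set V, C.Finite → C.Nonempty → ¬ ∀ u ∈ C, ∀ w, G.Adj u w → w ∈ C)
    (hdeg : ∀ v a b c, G.Adj v a → G.Adj v b → G.Adj v c → a = b ∨ a = c ∨ b = c)
    (hleaf : ∀ v, ∃ a b, G.Adj v a ∧ G.Adj v b ∧ a ≠ b) [Nonempty V] :
    ∃ x : ℤ → V, Function.Injective x ∧
      ∀ i u, G.Adj (x i) u ↔ u = x (i - 1) ∨ u = x (i + 1) := by
  have hother : ∀ d : G.Dart, ∃ e : G.Dart, e.fst = d.snd ∧ e.snd ≠ d.fst := fun d => by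
    obtain ⟨a, b, ha, hb, hab⟩ := hleaf d.snd
    by_cases h : a = d.fst
    · exact ⟨⟨(d.snd, b), hb⟩, rfl, fun h' => hab (h.trans h'.symm)⟩
    · exact ⟨⟨(d.snd, a), ha⟩, rfl, h⟩
  choose next hnext hback using hother
  have hthree : ∀ d e : G.Dart, e.fst = d.snd → e.snd ≠ d.fst → e = next d := fun d e h1 h2 => by
    have a1 := (next d).adj
    have a2 := e.adj
    rw [hnext] at a1
    rw [h1] at a2
    rcases hdeg _ _ _ _ d.adj.symm a1 a2 with h | h | h
    · exact absurd h.symm (hback d)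
    · exact absurd h.symm h2
    · ext
      · rw [h1, hnext]
      · exact h.symm
  have hsymm : ∀ d, next (next d).symm = d.symm := fun d =>
    (hthree _ _ (hnext d).symm (hback d).symm).symm
  let σ : Equiv.Perm G.Dart :=
    { toFun := next
      invFun := fun d => (next d.symm).symm
      left_inv := fun d => by simp [hsymm]
      right_inv := fun d => by simpa using hsymm d.symm }
  have hσ : ∀ d, σ d = next d := fun d => rfl
  obtain ⟨v⟩ := ‹Nonempty V›
  obtain ⟨a, _, ha, _⟩ := hleaf v
  let d : G.Dart := ⟨(v, a), ha⟩
  let x : ℤ → V := fun i => ((σ ^ i) d).fst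
  have hsnd : ∀ i, ((σ ^ i) d).snd = x (i + 1) := fun i => by
    change _ = ((σ ^ (i + 1)) d).fst
    rw [add_comm, zpow_one_add, Equiv.Perm.mul_apply, hσ, hnext]
  have hadj : ∀ i, G.Adj (x i) (x (i + 1)) := fun i => hsnd i ▸ ((σ ^ i) d).adj
  have hne : ∀ i, x (i - 1) ≠ x (i + 1) := fun i => by
    have := hback ((σ ^ (i - 1)) d)
    rw [← hσ, ← Equiv.Perm.mul_apply, ← zpow_one_add, add_sub_cancel, hsnd] at this
    exact this.symm
  have hnbr : ∀ i u, G.Adj (x i) u ↔ u = x (i - 1) ∨ u = x (i + 1) := fun i u => by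
    have h1 : G.Adj (x i) (x (i - 1)) := by simpa using (hadj (i - 1)).symm
    constructor
    · intro h
      rcases hdeg _ _ _ _ h h1 (hadj i) with h | h | h
      · exact Or.inl h
      · exact Or.inr h
      · exact absurd h (hne i)
    · rintro (rfl | rfl)
      · exact h1
      · exact hadj i
  refine ⟨x, ?_, hnbr⟩
  have hrefl : ∀ (k : ℕ) i j, x i = x j → x (i + 1) = x (j - 1) →
      x (i + k) = x (j - k) ∧ x (i + k + 1) = x (j - k - 1) := by
    intro k i j h1 h2
    induction k with
    | zero => simpa using ⟨h1, h2⟩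
    | succ k ih =>
      have e1 : i + ((k + 1 : ℕ) : ℤ) = i + k + 1 := by push_cast; ring
      have e2 : j - ((k + 1 : ℕ) : ℤ) = j - k - 1 := by push_cast; ring
      rw [e1, e2]
      refine ⟨ih.2, ?_⟩
      have h3 := (hnbr (j - k - 1) (x (i + k + 1 + 1))).1 (ih.2 ▸ hadj _)
      rcases h3 with h3 | h3
      · exact h3
      · rw [sub_add_cancel, ← ih.1] at h3
        have := hne (i + k + 1)
        rw [add_sub_cancel_right] at this
        exact absurd h3.symm this
  have hlt : ∀ i j, i < j → x i ≠ x j := by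
    intro i j hij h
    have h1 := (hnbr j (x (i + 1))).1 (h ▸ hadj i)
    rcases h1 with h1 | h1
    · obtain ⟨m, hm | hm⟩ : ∃ m : ℕ, j = i + 2 * m ∨ j = i + 2 * m + 1 :=
        ⟨((j - i) / 2).toNat, by omega⟩
      · obtain ⟨k, rfl⟩ : ∃ k, m = k + 1 := ⟨m - 1, by omega⟩
        have h2 := (hrefl k i j h h1).1
        have h3 := hne (i + k + 1)
        rw [add_sub_cancel_right] at h3
        exact h3 (h2.trans (congrArg x (by rw [hm]; push_cast; ring)))
      · have h2 := (hrefl m i j h h1).1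
        have h3 := hadj (i + m)
        rw [h2] at h3
        exact h3.ne (congrArg x (by rw [hm]; ring))
    · have hd : (σ ^ i) d = (σ ^ j) d := by
        ext
        · exact h
        · rw [hsnd, hsnd, h1]
      have hper : ∀ k, x (i + k) = x (j + k) := fun k => by
        change ((σ ^ (i + k)) d).fst = ((σ ^ (j + k)) d).fst
        rw [add_comm i, add_comm j, zpow_add, zpow_add, Equiv.Perm.mul_apply,
          Equiv.Perm.mul_apply, hd]
      have hp : Function.Periodic x (j - i) := fun k => by
        have := hper (k - i)
        rw [add_sub_cancel] at this
        rw [this]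
        exact congrArg x (by ring)
      refine hinf (Set.range x) ?_ ⟨_, Set.mem_range_self 0⟩ ?_
      · refine ((Set.finite_Ico (0 : ℤ) (j - i)).image x).subset ?_
        rintro _ ⟨k, rfl⟩
        obtain ⟨m, hm, hxm⟩ := hp.exists_mem_Ico₀ (by omega) k
        exact ⟨m, hm, hxm.symm⟩
      · rintro _ ⟨k, rfl⟩ w hw
        rcases (hnbr k w).1 hw with rfl | rfl <;> exact Set.mem_range_self _
  intro i j h
  rcases lt_trichotomy i j with hij | hij | hij
  · exact absurd h (hlt _ _ hij)
  · exact hij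
  · exact absurd h.symm (hlt _ _ hij)

/-- A graph without finite components and twin leaves that omits the triangle, the 4-cycle and the
extended Dynkin diagram of type `E₈` has maximal degree two. -/
theorem SimpleGraph.degree_le_two_of_forbidden {V : Type*} {G : SimpleGraph V}
    (hfin : ∀ v, (G.neighborSet v).Finite)
    (hinf : ∀ C : Set V, C.Finite → C.Nonempty → ¬ ∀ u ∈ C, ∀ w, G.Adj u w → w ∈ C)
    (htwin : ∀ v a b, a ≠ b → (∀ u, G.Adj a u ↔ u = v) → ¬ ∀ u, G.Adj b u ↔ u = v)
    (hC4 : ∀ x : Fin 4 → V, Function.Injective x → G.Adj (x 0) (x 1) → G.Adj (x 1) (x 2) →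
      G.Adj (x 2) (x 3) → ¬ G.Adj (x 3) (x 0))
    (hE8 : ∀ x : Fin 9 → V, Function.Injective x → G.Adj (x 0) (x 1) → G.Adj (x 0) (x 2) →
      G.Adj (x 2) (x 3) → G.Adj (x 0) (x 4) → G.Adj (x 4) (x 5) → G.Adj (x 5) (x 6) →
      G.Adj (x 6) (x 7) → ¬ G.Adj (x 7) (x 8))
    (hC3 : ∀ x : Fin 3 → V, Function.Injective x → G.Adj (x 0) (x 1) → G.Adj (x 1) (x 2) →
      ¬ G.Adj (x 2) (x 0))
    (v a b c : V) (ha : G.Adj v a) (hb : G.Adj v b) (hc : G.Adj v c) :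
    a = b ∨ a = c ∨ b = c := by
  by_contra! hne
  obtain ⟨x5, r5, d5⟩ := SimpleGraph.exists_dist_eq hfin hinf v 5
  obtain ⟨x4, a4, r4, d4⟩ := SimpleGraph.exists_adj_dist_eq r5 d5
  obtain ⟨x3, a3, r3, d3⟩ := SimpleGraph.exists_adj_dist_eq r4 d4
  obtain ⟨x2, a2, r2, d2⟩ := SimpleGraph.exists_adj_dist_eq r3 d3
  obtain ⟨x1, a1, r1, d1⟩ := SimpleGraph.exists_adj_dist_eq r2 d2
  have a0 : G.Adj x1 v := SimpleGraph.dist_eq_one_iff_adj.1 d1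
  have main : ∀ p q, G.Adj v p → G.Adj v q → p ≠ q → p ≠ x1 → q ≠ x1 →
      ∀ u, G.Adj p u ↔ u = v := by
    intro p q hp hq hpq hp1 hq1 u
    refine ⟨fun hu => ?_, fun h => h ▸ hp.symm⟩
    by_contra huv
    have dp : G.dist p v = 1 := SimpleGraph.dist_eq_one_iff_adj.2 hp.symm
    have dq : G.dist q v = 1 := SimpleGraph.dist_eq_one_iff_adj.2 hq.symm
    have d0 : G.dist v v = 0 := SimpleGraph.dist_self
    have hvu : ¬ G.Adj v u := fun h => by
      refine hC3 ![v, p, u] ?_ hp hu h.symm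
      intro i j hij
      fin_cases i <;> fin_cases j <;> simp_all [hp.ne, hp.ne', hu.ne, hu.ne', h.ne, h.ne']
    have du : G.dist u v ≤ 2 := by
      have := hu.symm.dist_le_succ (v := v)
      omega
    have hu1 : u ≠ x1 := by rintro rfl; exact hvu a0.symm
    have huq : u ≠ q := by rintro rfl; exact hvu hq
    by_cases hu2 : u = x2
    · subst hu2
      refine hC4 ![v, p, u, x1] ?_ hp hu a1 a0
      intro i j hij
      fin_cases i <;> fin_cases j <;> simp at hij <;> first | rfl | grind
    · refine hE8 ![v, q, p, u, x1, x2, x3, x4, x5] ?_ hq hp hu a0.symm a1.symm a2.symm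
        a3.symm a4.symm
      have hpu := hu.ne
      intro i j hij
      fin_cases i <;> fin_cases j <;> simp at hij <;> first | rfl | grind
  obtain ⟨p, q, hp, hq, hpq, hp1, hq1⟩ :
      ∃ p q, G.Adj v p ∧ G.Adj v q ∧ p ≠ q ∧ p ≠ x1 ∧ q ≠ x1 := by
    by_cases h1 : a = x1
    · exact ⟨b, c, hb, hc, hne.2.2, h1 ▸ hne.1.symm, h1 ▸ hne.2.1.symm⟩
    · by_cases h2 : b = x1
      · exact ⟨a, c, ha, hc, hne.2.1, h1, h2 ▸ hne.2.2.symm⟩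
      · exact ⟨a, b, ha, hb, hne.1, h1, h2⟩
  exact htwin v p q hpq (main p q hp hq hpq hp1 hq1) (main q p hq hp hpq.symm hq1 hp1)

theorem lp_sum_smul_apply {ι α : Type*} (s : Finset ι) (c : ι → ℂ) (g : ι → lp (fun _ : α => ℂ) 2)
    (a : α) : (∑ i ∈ s, c i • g i : lp (fun _ : α => ℂ) 2) a = ∑ i ∈ s, c i * g i a := by
  classical
  induction s using Finset.induction_on with
  | empty => rfl
  | insert i s hi ih =>
    rw [Finset.sum_insert hi, Finset.sum_insert hi, ← ih]
    rfl

section AdjacencyOperator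

variable {V : Type} {G : SimpleGraph V}
  {A : lp (fun _ : V => ℂ) 2 →L[ℂ] lp (fun _ : V => ℂ) 2}

open Classical in
theorem adjOp_single (hfin : ∀ v, (G.neighborSet v).Finite)
    (hA : ∀ (ξ : lp (fun _ : V => ℂ) 2) (v : V), A ξ v = ∑ᶠ w ∈ G.neighborSet v, ξ w)
    (u v : V) : A (lp.single 2 v 1) u = if G.Adj u v then 1 else 0 := by
  rw [hA, finsum_mem_eq_finite_toFinset_sum _ (hfin u)]
  simp [Pi.single_apply]

/-- If the adjacency operator has no eigenvectors, the graph has no finite components. -/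
theorem infinite_of_no_eigenvector
    (hA : ∀ (ξ : lp (fun _ : V => ℂ) 2) (v : V), A ξ v = ∑ᶠ w ∈ G.neighborSet v, ξ w)
    (heig : ∀ (μ : ℂ) x, A x = μ • x → x = 0)
    (C : Set V) (hC : C.Finite) (hne : C.Nonempty) :
    ¬ ∀ u ∈ C, ∀ w, G.Adj u w → w ∈ C := by
  classical
  intro hcl
  let W : Submodule ℂ (lp (fun _ : V => ℂ) 2) :=
    { carrier := {x | ∀ v ∉ C, x v = 0}
      add_mem' := fun {x y} hx hy v hv => by simp [hx v hv, hy v hv]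
      zero_mem' := fun v _ => by simp
      smul_mem' := fun c x hx v hv => by simp [hx v hv] }
  have hW : ∀ x ∈ W, (A : lp (fun _ : V => ℂ) 2 →ₗ[ℂ] lp (fun _ : V => ℂ) 2) x ∈ W := by
    intro x hx v hv
    change A x v = 0
    rw [hA]
    refine finsum_mem_eq_zero_of_forall_eq_zero fun w hw => hx w fun hwC => hv ?_
    exact hcl w hwC v hw.symm
  have : Finite C := hC
  let r : W →ₗ[ℂ] (C → ℂ) :=
    { toFun := fun x v => (x : lp (fun _ : V => ℂ) 2) v
      map_add' := fun x y => by ext; simp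
      map_smul' := fun c x => by ext; simp }
  have hr : Function.Injective r := by
    intro x y hxy
    ext v
    by_cases hv : v ∈ C
    · exact congrFun hxy ⟨v, hv⟩
    · rw [x.2 v hv, y.2 v hv]
  have : FiniteDimensional ℂ W := FiniteDimensional.of_injective r hr
  obtain ⟨v, hv⟩ := hne
  have : Nontrivial W := by
    refine ⟨⟨⟨lp.single 2 v 1, fun u hu => ?_⟩, 0, fun h => ?_⟩⟩
    · exact lp.single_apply_ne _ _ _ (by rintro rfl; exact hu hv)
    · have := congrArg (fun x : W => (x : lp (fun _ : V => ℂ) 2) v) h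
      simp at this
  obtain ⟨μ, hμ⟩ := Module.End.exists_eigenvalue (LinearMap.restrict _ hW)
  obtain ⟨x, hx⟩ := hμ.exists_hasEigenvector
  refine hx.2 (Subtype.ext (heig μ x ?_))
  exact congrArg Subtype.val hx.apply_eq_smul

theorem no_twin_leaves (hfin : ∀ v, (G.neighborSet v).Finite)
    (hA : ∀ (ξ : lp (fun _ : V => ℂ) 2) (v : V), A ξ v = ∑ᶠ w ∈ G.neighborSet v, ξ w)
    (heig : ∀ (μ : ℂ) x, A x = μ • x → x = 0) (v a b : V) (hab : a ≠ b)
    (ha : ∀ u, G.Adj a u ↔ u = v) : ¬ ∀ u, G.Adj b u ↔ u = v := by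
  classical
  intro hb
  have h := heig 0 (lp.single 2 a 1 - lp.single 2 b 1) (by
    ext u
    rw [map_sub, lp.coeFn_sub, Pi.sub_apply, adjOp_single hfin hA, adjOp_single hfin hA]
    simp [G.adj_comm u, ha, hb])
  have := congrArg (fun x : lp (fun _ : V => ℂ) 2 => x a) h
  simp [hab] at this

/-- A finite graph with a positive weight whose adjacency form is at least `2` is not a subgraph. -/
theorem not_embedded_of_weights (hfin : ∀ v, (G.neighborSet v).Finite)
    (hA : ∀ (ξ : lp (fun _ : V => ℂ) 2) (v : V), A ξ v = ∑ᶠ w ∈ G.neighborSet v, ξ w)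
    (hlt : ∀ x, x ≠ 0 → (inner ℂ x (A x)).re < 2 * ‖x‖ ^ 2) {k : ℕ} (c : Fin k → ℕ)
    (H : Fin k → Fin k → Prop) [DecidableRel H]
    (hpos : 0 < ∑ i, c i ^ 2)
    (hc : 2 * ∑ i, c i ^ 2 ≤ ∑ i, ∑ j, if H i j then c i * c j else 0)
    (x : Fin k → V) (hx : Function.Injective x) :
    ¬ ∀ i j, H i j → G.Adj (x i) (x j) := by
  classical
  intro hH
  let f : lp (fun _ : V => ℂ) 2 := ∑ i, (c i : ℂ) • lp.single 2 (x i) 1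
  have hcoe : ∀ i, f (x i) = c i := fun i => by
    rw [lp_sum_smul_apply]
    simp [Pi.single_apply, hx.eq_iff]
  have hin : ∀ g : lp (fun _ : V => ℂ) 2, inner ℂ f g = ∑ i, (c i : ℂ) * g (x i) := fun g => by
    simp [f, lp.inner_single_left, mul_comm]
  have hnorm : ‖f‖ ^ 2 = ((∑ i, c i ^ 2 : ℕ) : ℝ) := by
    rw [← inner_self_eq_norm_sq (𝕜 := ℂ), hin]
    simp only [hcoe]
    norm_cast
    simp [sq]
  have hq : (inner ℂ f (A f)).re =
      ((∑ i, ∑ j, if G.Adj (x i) (x j) then c i * c j else 0 : ℕ) : ℝ) := by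
    have : inner ℂ f (A f) =
      ((∑ i, ∑ j, if G.Adj (x i) (x j) then c i * c j else 0 : ℕ) : ℂ) := by
      rw [hin]
      push_cast
      refine Finset.sum_congr rfl fun i _ => ?_
      simp only [f, map_sum, map_smul]
      rw [lp_sum_smul_apply, Finset.mul_sum]
      simp [adjOp_single hfin hA]
    rw [this, Complex.natCast_re]
  have hf : f ≠ 0 := fun h => by
    rw [h] at hnorm
    simp only [norm_zero] at hnorm
    norm_cast at hnorm
    simp only [ne_eq, OfNat.ofNat_ne_zero, not_false_eq_true, zero_pow] at hnorm
    omega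
  have h1 := hlt f hf
  rw [hq, hnorm] at h1
  have h2 : (∑ i, ∑ j, if H i j then c i * c j else 0) ≤
      ∑ i, ∑ j, if G.Adj (x i) (x j) then c i * c j else 0 := by
    refine Finset.sum_le_sum fun i _ => Finset.sum_le_sum fun j _ => ?_
    by_cases h : H i j
    · simp [h, hH i j h]
    · simp [h]
  have h3 : (∑ i, ∑ j, if G.Adj (x i) (x j) then c i * c j else 0) < 2 * ∑ i, c i ^ 2 := by
    exact_mod_cast h1
  omega

end AdjacencyOperator

open Classical in
theorem orthonormal_single (V : Type*) :
    Orthonormal ℂ (fun v : V => (lp.single 2 v 1 : lp (fun _ : V => ℂ) 2)) := by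
  rw [orthonormal_iff_ite]
  intro u v
  rw [lp.inner_single_left]
  simp [Pi.single_apply]

/-- A two-way infinite line component is incompatible with multiplicity one: its odd functions form
a proper invariant subspace on which the operator acts as that of the ray. -/
theorem not_isLine_of_complete {V : Type} {G : SimpleGraph V}
    {A : lp (fun _ : V => ℂ) 2 →L[ℂ] lp (fun _ : V => ℂ) 2}
    (hfin : ∀ v, (G.neighborSet v).Finite)
    (hA : ∀ (ξ : lp (fun _ : V => ℂ) 2) (v : V), A ξ v = ∑ᶠ w ∈ G.neighborSet v, ξ w)
    (hcomp : ∀ f : ℕ → lp (fun _ : V => ℂ) 2, Orthonormal ℂ f → A (f 0) = f 1 →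
      (∀ n, A (f (n + 1)) = f n + f (n + 2)) → ∀ v, ¬ ∀ n, f n v = 0)
    {x : ℤ → V} (hinj : Function.Injective x)
    (hadj : ∀ i u, G.Adj (x i) u ↔ u = x (i - 1) ∨ u = x (i + 1)) : False := by
  classical
  let e : ℤ → lp (fun _ : V => ℂ) 2 := fun i => lp.single 2 (x i) 1
  have he : ∀ i j, inner ℂ (e i) (e j) = if i = j then (1 : ℂ) else 0 :=
    orthonormal_iff_ite.1 ((orthonormal_single V).comp x hinj)
  have hAe : ∀ i, A (e i) = e (i - 1) + e (i + 1) := fun i => by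
    ext u
    have : x (i - 1) ≠ x (i + 1) := fun h => by have := hinj h; omega
    rw [adjOp_single hfin hA, G.adj_comm, hadj]
    simp only [e, lp.coeFn_add, Pi.add_apply, lp.coeFn_single, Pi.single_apply]
    grind
  let s : ℂ := ((√2)⁻¹ : ℝ)
  have hs : s * s = 1 / 2 := by
    rw [← Complex.ofReal_mul, ← mul_inv, Real.mul_self_sqrt (by norm_num)]
    simp
  let f : ℕ → lp (fun _ : V => ℂ) 2 := fun n => s • (e (n + 1) - e (-(n + 1)))
  refine hcomp f ?_ ?_ (fun n => ?_) (x 0) fun n => ?_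
  · rw [orthonormal_iff_ite]
    intro m n
    have h1 : ¬ ((m : ℤ) + 1 = -(n + 1)) := by omega
    have h2 : ¬ (-((m : ℤ) + 1) = n + 1) := by omega
    have hsc : (starRingEnd ℂ) s = s := Complex.conj_ofReal _
    simp only [f, inner_smul_left, inner_smul_right, inner_sub_left, inner_sub_right, he, h1, h2,
      if_false, neg_inj, add_left_inj, Nat.cast_inj, hsc]
    split_ifs
    · linear_combination 2 * hs
    · ring
  · have h1 : ((0 : ℕ) : ℤ) + 1 - 1 = -(((0 : ℕ) : ℤ) + 1) + 1 := by simp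
    have h2 : -(((0 : ℕ) : ℤ) + 1) - 1 = -(((1 : ℕ) : ℤ) + 1) := by simp
    have h3 : ((0 : ℕ) : ℤ) + 1 + 1 = ((1 : ℕ) : ℤ) + 1 := by simp
    simp only [f, map_smul, map_sub, hAe, h1, h2, h3]
    module
  · have h1 : ((n + 1 : ℕ) : ℤ) + 1 - 1 = n + 1 := by push_cast; ring
    have h2 : -(((n + 1 : ℕ) : ℤ) + 1) - 1 = -(((n + 2 : ℕ) : ℤ) + 1) := by push_cast; ring
    have h3 : ((n + 1 : ℕ) : ℤ) + 1 + 1 = ((n + 2 : ℕ) : ℤ) + 1 := by push_cast; ring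
    have h4 : -(((n + 1 : ℕ) : ℤ) + 1) + 1 = -((n : ℤ) + 1) := by push_cast; ring
    simp only [f, map_smul, map_sub, hAe, h1, h2, h3, h4]
    module
  · have h1 : x 0 ≠ x (n + 1) := fun h => by have := hinj h; omega
    have h2 : x 0 ≠ x (-(n + 1)) := fun h => by have := hinj h; omega
    change s * (e (n + 1) (x 0) - e (-(n + 1)) (x 0)) = 0
    rw [lp.single_apply_ne _ _ _ h1, lp.single_apply_ne _ _ _ h2, sub_zero, mul_zero]

/-- The infinite ray is determined by its marked spectrum: any graph of bounded degree whose
adjacency operator is unitarily equivalent to that of the infinite ray is isomorphic to the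
infinite ray. -/
theorem stmt_15 {V : Type} [Countable V] (G : SimpleGraph V)
    (hfin : ∀ v, (G.neighborSet v).Finite)
    (hbdd : ∃ D : ℕ, ∀ v, (G.neighborSet v).ncard ≤ D)
    (A : lp (fun _ : V => ℂ) 2 →L[ℂ] lp (fun _ : V => ℂ) 2)
    (hA : ∀ (ξ : lp (fun _ : V => ℂ) 2) (v : V), A ξ v = ∑ᶠ w ∈ G.neighborSet v, ξ w)
    (AR : lp (fun _ : ℕ => ℂ) 2 →L[ℂ] lp (fun _ : ℕ => ℂ) 2)
    (hAR : ∀ (ξ : lp (fun _ : ℕ => ℂ) 2) (n : ℕ),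
      AR ξ n = (if n = 0 then 0 else ξ (n - 1)) + ξ (n + 1))
    (hequiv : ∃ U : lp (fun _ : V => ℂ) 2 ≃ₗᵢ[ℂ] lp (fun _ : ℕ => ℂ) 2,
      ∀ ξ, U (A ξ) = AR (U ξ)) :
    Nonempty (G ≃g rayGraph) := by
  classical
  obtain ⟨U, hU⟩ := hequiv
  have heig : ∀ (μ : ℂ) x, A x = μ • x → x = 0 := fun μ x hx => by
    have h := ray_no_eigenvector hAR (μ := μ) (x := U x) (by rw [← hU, hx, map_smul])
    simpa using h
  have hlt : ∀ x, x ≠ 0 → (inner ℂ x (A x)).re < 2 * ‖x‖ ^ 2 := fun x hx => by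
    have h := ray_inner_lt hAR (x := U x) (by simpa using hx)
    rwa [← hU, U.inner_map_map, U.norm_map] at h
  have hcomp : ∀ f : ℕ → lp (fun _ : V => ℂ) 2, Orthonormal ℂ f → A (f 0) = f 1 →
      (∀ n, A (f (n + 1)) = f n + f (n + 2)) → ∀ v, ¬ ∀ n, f n v = 0 := by
    intro f ho h0 hf v hv
    have h := ray_complete hAR (f := fun n => U (f n)) (g := U (lp.single 2 v 1))
      (ho.comp_linearIsometry U.toLinearIsometry) (by rw [← hU, h0])
      (fun n => by rw [← hU, hf, map_add])
      (fun n => by simp [lp.inner_single_right, hv])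
    have h' : lp.single 2 v (1 : ℂ) = (0 : lp (fun _ : V => ℂ) 2) := by simpa using h
    have := congrArg (fun x : lp (fun _ : V => ℂ) 2 => x v) h'
    simp at this
  have : Nonempty V := by
    by_contra h
    rw [not_nonempty_iff] at h
    have h1 : U.symm (lp.single 2 0 1) = 0 := by ext v; exact h.elim v
    have h2 : lp.single 2 0 (1 : ℂ) = (0 : lp (fun _ : ℕ => ℂ) 2) := by simpa using h1
    have := congrArg (fun x : lp (fun _ : ℕ => ℂ) 2 => x 0) h2
    simp at this
  have hinf := infinite_of_no_eigenvector hA heig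
  have hdeg : ∀ v a b c, G.Adj v a → G.Adj v b → G.Adj v c → a = b ∨ a = c ∨ b = c := by
    refine SimpleGraph.degree_le_two_of_forbidden hfin hinf (no_twin_leaves hfin hA heig) ?_ ?_ ?_
    · intro x hx h0 h1 h2 h3
      refine not_embedded_of_weights hfin hA hlt (fun _ => 1)
        (fun i j => (i, j) ∈ [(0, 1), (1, 2), (2, 3), (3, 0), (1, 0), (2, 1), (3, 2), (0, 3)])
        (by decide) (by decide) x hx ?_
      simp only [List.mem_cons, Prod.mk.injEq, List.not_mem_nil, or_false]
      rintro i j (⟨rfl, rfl⟩ | ⟨rfl, rfl⟩ | ⟨rfl, rfl⟩ | ⟨rfl, rfl⟩ | ⟨rfl, rfl⟩ | ⟨rfl, rfl⟩ |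
        ⟨rfl, rfl⟩ | ⟨rfl, rfl⟩) <;> first | assumption | (apply SimpleGraph.Adj.symm; assumption)
    · intro x hx h0 h1 h2 h3 h4 h5 h6 h7
      refine not_embedded_of_weights hfin hA hlt ![6, 3, 4, 2, 5, 4, 3, 2, 1]
        (fun i j => (i, j) ∈ [(0, 1), (0, 2), (2, 3), (0, 4), (4, 5), (5, 6), (6, 7), (7, 8),
          (1, 0), (2, 0), (3, 2), (4, 0), (5, 4), (6, 5), (7, 6), (8, 7)])
        (by decide) (by decide) x hx ?_
      simp only [List.mem_cons, Prod.mk.injEq, List.not_mem_nil, or_false]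
      rintro i j (⟨rfl, rfl⟩ | ⟨rfl, rfl⟩ | ⟨rfl, rfl⟩ | ⟨rfl, rfl⟩ | ⟨rfl, rfl⟩ | ⟨rfl, rfl⟩ |
        ⟨rfl, rfl⟩ | ⟨rfl, rfl⟩ | ⟨rfl, rfl⟩ | ⟨rfl, rfl⟩ | ⟨rfl, rfl⟩ | ⟨rfl, rfl⟩ |
        ⟨rfl, rfl⟩ | ⟨rfl, rfl⟩ | ⟨rfl, rfl⟩ | ⟨rfl, rfl⟩) <;>
        first | assumption | (apply SimpleGraph.Adj.symm; assumption)
    · intro x hx h0 h1 h2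
      refine not_embedded_of_weights hfin hA hlt (fun _ => 1)
        (fun i j => (i, j) ∈ [(0, 1), (1, 2), (2, 0), (1, 0), (2, 1), (0, 2)])
        (by decide) (by decide) x hx ?_
      simp only [List.mem_cons, Prod.mk.injEq, List.not_mem_nil, or_false]
      rintro i j (⟨rfl, rfl⟩ | ⟨rfl, rfl⟩ | ⟨rfl, rfl⟩ | ⟨rfl, rfl⟩ | ⟨rfl, rfl⟩ | ⟨rfl, rfl⟩) <;>
        first | assumption | (apply SimpleGraph.Adj.symm; assumption)
  by_cases hleaf : ∀ v, ∃ a b, G.Adj v a ∧ G.Adj v b ∧ a ≠ b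
  · exfalso
    obtain ⟨x, hinj, hadj⟩ := SimpleGraph.exists_line hinf hdeg hleaf
    exact not_isLine_of_complete hfin hA hcomp hinj hadj
  · push Not at hleaf
    obtain ⟨v, hv⟩ := hleaf
    obtain ⟨x, hinj, h0, hs⟩ := SimpleGraph.exists_ray hfin hinf hdeg hv
    have hsurj : Function.Surjective x := by
      intro w
      by_contra! hw
      refine hcomp (fun n => lp.single 2 (x n) 1) ?_ ?_ (fun n => ?_) w fun n => ?_
      · exact (orthonormal_single V).comp x hinj
      · ext u
        rw [adjOp_single hfin hA, G.adj_comm, h0]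
        simp [Pi.single_apply]
      · ext u
        have : x n ≠ x (n + 2) := fun h => by have := hinj h; omega
        rw [adjOp_single hfin hA, G.adj_comm, hs]
        simp only [lp.coeFn_add, Pi.add_apply, lp.coeFn_single, Pi.single_apply]
        grind
      · exact lp.single_apply_ne _ _ _ (hw n).symm
    refine ⟨(RelIso.mk (Equiv.ofBijective x ⟨hinj, hsurj⟩) ?_ : rayGraph ≃g G).symm⟩
    intro m n
    change G.Adj (x m) (x n) ↔ rayGraph.Adj m n
    rw [rayGraph, SimpleGraph.fromRel_adj]
    cases m with
    | zero => rw [h0, hinj.eq_iff]; omega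
    | succ m => rw [hs, hinj.eq_iff, hinj.eq_iff]; omega
end
end

section
/- For every real number a with 0 < a ≤ √2, the Jacobi operator J_a is unitarily equivalent to J_1, i.e. to the free Jacobi matrix, which is the adjacency operator A_R of the infinite ray. -/
noncomputable section

open scoped InnerProductSpace ComplexConjugate

section PolarDecomposition

variable {H K : Type*} [NormedAddCommGroup H] [InnerProductSpace ℂ H] [CompleteSpace H]
  [NormedAddCommGroup K] [InnerProductSpace ℂ K] [CompleteSpace K]

theorem denseRange_of_adjoint_injective (T : H →L[ℂ] K)
    (hT : ∀ y, T.adjoint y = 0 → y = 0) : DenseRange T := by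
  have h : T.range.topologicalClosure = ⊤ := by
    rw [Submodule.topologicalClosure_eq_top_iff, ContinuousLinearMap.orthogonal_range,
      Submodule.eq_bot_iff]
    exact fun y hy => hT y hy
  have h2 := (Submodule.dense_iff_topologicalClosure_eq_top).2 h
  exact h2

theorem norm_cfcAbs_apply (S : H →L[ℂ] H) (x : H) : ‖CFC.abs S x‖ = ‖S x‖ := by
  have hsa : ContinuousLinearMap.adjoint (CFC.abs S) = CFC.abs S :=
    (IsSelfAdjoint.of_nonneg (CFC.abs_nonneg S)).star_eq
  have hsq : CFC.abs S (CFC.abs S x) = S.adjoint (S x) :=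
    DFunLike.congr_fun (CFC.abs_mul_abs S) x
  have h : ⟪CFC.abs S x, CFC.abs S x⟫_ℂ = ⟪S x, S x⟫_ℂ := by
    rw [← ContinuousLinearMap.adjoint_inner_right, hsa, hsq,
      ContinuousLinearMap.adjoint_inner_right]
  rw [inner_self_eq_norm_sq_to_K, inner_self_eq_norm_sq_to_K] at h
  have h' : ‖CFC.abs S x‖ ^ 2 = ‖S x‖ ^ 2 := by exact_mod_cast h
  exact (sq_eq_sq₀ (norm_nonneg _) (norm_nonneg _)).1 h'

/-- Two self-adjoint operators intertwined by an injective operator with dense range are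
unitarily equivalent, through the unitary part of its polar decomposition. -/
theorem exists_unitary_intertwining {S X Y : H →L[ℂ] H} (hX : IsSelfAdjoint X)
    (hY : IsSelfAdjoint Y) (hS : S * X = Y * S) (hinj : ∀ x, S x = 0 → x = 0)
    (hdense : DenseRange S) : ∃ U : H ≃ₗᵢ[ℂ] H, ∀ x, U (X x) = Y (U x) := by
  have hstar : X * star S = star S * Y := by
    simpa [hX.star_eq, hY.star_eq] using congrArg star hS
  have hcomm : Commute (star S * S) X := by
    change star S * S * X = X * (star S * S)
    rw [mul_assoc, hS, ← mul_assoc, ← hstar, mul_assoc]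
  have habs : Commute (CFC.abs S) X := hcomm.cfcₙ_nnreal _
  have hsa : ContinuousLinearMap.adjoint (CFC.abs S) = CFC.abs S :=
    (IsSelfAdjoint.of_nonneg (CFC.abs_nonneg S)).star_eq
  have hdense' : DenseRange (CFC.abs S : H →L[ℂ] H) := by
    refine denseRange_of_adjoint_injective _ fun y hy => hinj y ?_
    rw [hsa] at hy
    rw [← norm_eq_zero, ← norm_cfcAbs_apply, hy, norm_zero]
  let U : H ≃ₗᵢ[ℂ] H := (LinearEquiv.refl ℂ H).extendOfIsometry
    (CFC.abs S : H →L[ℂ] H).toLinearMap S.toLinearMap hdense' hdense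
    fun x => (norm_cfcAbs_apply S x).symm
  have hU : ∀ x, U (CFC.abs S x) = S x := fun x =>
    LinearEquiv.extendOfIsometry_eq (LinearEquiv.refl ℂ H)
      (CFC.abs S : H →L[ℂ] H).toLinearMap S.toLinearMap hdense' hdense
      (fun x => (norm_cfcAbs_apply S x).symm) x
  refine ⟨U, fun x => ?_⟩
  refine hdense'.induction (P := fun x => U (X x) = Y (U x)) ?_
    (isClosed_eq (by fun_prop) (by fun_prop)) x
  rintro _ ⟨y, rfl⟩
  have h1 : X (CFC.abs S y) = CFC.abs S (X y) := (DFunLike.congr_fun habs.eq y).symm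
  rw [h1, hU, hU]
  exact DFunLike.congr_fun hS y

end PolarDecomposition

section SequenceSpace

local notation "ℓ²" => lp (fun _ : ℕ => ℂ) 2

theorem isSelfAdjoint_of_single {T : ℓ² →L[ℂ] ℓ²}
    (hT : ∀ m n, T (lp.single 2 n 1) m = conj (T (lp.single 2 m 1) n)) : IsSelfAdjoint T := by
  change T.adjoint = T
  refine lp.ext_continuousLinearMap (by simp) fun n => ?_
  ext m
  have h : ⟪lp.single 2 m (1 : ℂ), T.adjoint (lp.single 2 n 1)⟫_ℂ
      = ⟪lp.single 2 m (1 : ℂ), T (lp.single 2 n 1)⟫_ℂ := by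
    rw [ContinuousLinearMap.adjoint_inner_right, lp.inner_single_left, lp.inner_single_right, hT]
    simp
  rw [lp.inner_single_left, lp.inner_single_left] at h
  simpa using h

theorem tendsto_apply_zero (ξ : ℓ²) : Filter.Tendsto (fun n => ‖ξ n‖) Filter.atTop (nhds 0) := by
  have h := (lp.hasSum_single (by simp) ξ).summable.tendsto_atTop_zero.norm
  simpa [lp.norm_single] using h

theorem memℓp_shift (ξ : ℓ²) : Memℓp (fun n => ξ (n + 1)) 2 := by
  have h := (lp.memℓp ξ).summable (by simp)
  exact memℓp_gen ((summable_nat_add_iff 1).2 h)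

/-- The left shift on square-summable sequences. -/
def leftShift : ℓ² →L[ℂ] ℓ² :=
  LinearMap.mkContinuous
    { toFun := fun ξ => ⟨fun n => ξ (n + 1), memℓp_shift ξ⟩
      map_add' := fun _ _ => rfl
      map_smul' := fun _ _ => rfl } 1 fun ξ => by
    rw [one_mul]
    have hp : 0 < (2 : ENNReal).toReal := by simp
    refine lp.norm_le_of_tsum_le hp (norm_nonneg _) ?_
    have h := (lp.memℓp ξ).summable hp
    rw [lp.norm_rpow_eq_tsum hp, h.tsum_eq_zero_add]
    exact le_add_of_nonneg_left (by positivity)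

/-- The operator with `δ₀ ↦ a δ₀`, `δ₁ ↦ δ₁` and `δₙ ↦ δₙ - (a² - 1) δₙ₋₂` for `n ≥ 2`. -/
def jacobiIntertwiner (a : ℝ) : ℓ² →L[ℂ] ℓ² :=
  1 - ((a : ℂ) ^ 2 - 1) • (leftShift * leftShift)
    + ((a : ℂ) - 1) • (lp.singleContinuousLinearMap ℂ (fun _ : ℕ => ℂ) 2 0 ∘L
        lp.evalCLM ℂ (fun _ : ℕ => ℂ) 2 0)

theorem jacobiIntertwiner_apply_zero (a : ℝ) (ξ : ℓ²) :
    jacobiIntertwiner a ξ 0 = a * ξ 0 - ((a : ℂ) ^ 2 - 1) * ξ 2 := by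
  have h : jacobiIntertwiner a ξ 0
      = ξ 0 - ((a : ℂ) ^ 2 - 1) * ξ 2 + ((a : ℂ) - 1) * (lp.single 2 0 (ξ 0) : ℓ²) 0 := rfl
  rw [h, lp.single_apply_self]
  ring

theorem jacobiIntertwiner_apply_succ (a : ℝ) (ξ : ℓ²) (n : ℕ) :
    jacobiIntertwiner a ξ (n + 1) = ξ (n + 1) - ((a : ℂ) ^ 2 - 1) * ξ (n + 3) := by
  have h : jacobiIntertwiner a ξ (n + 1) = ξ (n + 1) - ((a : ℂ) ^ 2 - 1) * ξ (n + 3)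
      + ((a : ℂ) - 1) * (lp.single 2 0 (ξ 0) : ℓ²) (n + 1) := rfl
  rw [h, lp.single_apply_ne _ _ _ n.succ_ne_zero]
  ring

theorem jacobiIntertwiner_injective {a : ℝ} (ha : 0 < a) (ha' : a ≤ Real.sqrt 2) (ξ : ℓ²)
    (hξ : jacobiIntertwiner a ξ = 0) : ξ = 0 := by
  have hb : ‖(a : ℂ) ^ 2 - 1‖ ≤ 1 := by
    have h2 : a ^ 2 ≤ 2 := (Real.le_sqrt' ha).1 ha'
    have h : (a : ℂ) ^ 2 - 1 = ((a ^ 2 - 1 : ℝ) : ℂ) := by push_cast; ring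
    rw [h, Complex.norm_real, Real.norm_eq_abs, abs_le]
    constructor <;> nlinarith [sq_nonneg a]
  have hstep : ∀ n, ‖ξ (n + 1)‖ ≤ ‖ξ (n + 3)‖ := fun n => by
    have h := jacobiIntertwiner_apply_succ a ξ n
    rw [hξ, lp.coeFn_zero, Pi.zero_apply, eq_comm, sub_eq_zero] at h
    rw [h, norm_mul]
    exact mul_le_of_le_one_left (norm_nonneg _) hb
  have hsucc : ∀ n, ξ (n + 1) = 0 := fun n => by
    have hmono : Monotone fun k => ‖ξ (n + 1 + 2 * k)‖ := monotone_nat_of_le_succ fun k => by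
      have h := hstep (n + 2 * k)
      rwa [show n + 2 * k + 1 = n + 1 + 2 * k by ring,
        show n + 2 * k + 3 = n + 1 + 2 * (k + 1) by ring] at h
    have hlim : Filter.Tendsto (fun k => ‖ξ (n + 1 + 2 * k)‖) Filter.atTop (nhds 0) :=
      (tendsto_apply_zero ξ).comp
        (Filter.tendsto_atTop_mono (fun k => show k ≤ n + 1 + 2 * k by omega) Filter.tendsto_id)
    exact norm_le_zero_iff.1 (hmono.ge_of_tendsto hlim 0)
  have hzero := jacobiIntertwiner_apply_zero a ξ
  rw [hξ, hsucc 1, lp.coeFn_zero, Pi.zero_apply, mul_zero, sub_zero, eq_comm, mul_eq_zero] at hzero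
  ext n
  cases n with
  | zero => exact hzero.resolve_left (Complex.ofReal_ne_zero.2 ha.ne')
  | succ n => exact hsucc n

theorem denseRange_jacobiIntertwiner {a : ℝ} (ha : a ≠ 0) : DenseRange (jacobiIntertwiner a) := by
  refine denseRange_of_adjoint_injective _ fun η hη => ?_
  have horth : ∀ ξ, ⟪jacobiIntertwiner a ξ, η⟫_ℂ = 0 := fun ξ => by
    rw [← ContinuousLinearMap.adjoint_inner_right, hη, inner_zero_right]
  have hS0 : jacobiIntertwiner a (lp.single 2 0 1) = lp.single 2 0 (a : ℂ) := by
    ext n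
    cases n with
    | zero => simp [jacobiIntertwiner_apply_zero]
    | succ n => simp [jacobiIntertwiner_apply_succ]
  have hS1 : jacobiIntertwiner a (lp.single 2 1 1) = lp.single 2 1 1 := by
    ext n
    cases n with
    | zero => simp [jacobiIntertwiner_apply_zero]
    | succ n => simp [jacobiIntertwiner_apply_succ, Pi.single_apply]
  have hS2 : ∀ k, jacobiIntertwiner a (lp.single 2 (k + 2) 1)
      = lp.single 2 (k + 2) 1 - (lp.single 2 k ((a : ℂ) ^ 2 - 1) : ℓ²) := fun k => by
    ext n
    cases n with
    | zero =>
      simp [jacobiIntertwiner_apply_zero, Pi.single_apply, eq_comm]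
      split_ifs <;> ring
    | succ n =>
      simp [jacobiIntertwiner_apply_succ, Pi.single_apply,
        show n + 3 = k + 2 ↔ n + 1 = k by omega]
      split_ifs <;> ring
  ext n
  induction n using Nat.strong_induction_on with
  | _ n ih =>
    match n with
    | 0 =>
      have h := horth (lp.single 2 0 1)
      rw [hS0, lp.inner_single_left] at h
      simpa [ha] using h
    | 1 =>
      have h := horth (lp.single 2 1 1)
      rw [hS1, lp.inner_single_left] at h
      simpa using h
    | k + 2 =>
      have h := horth (lp.single 2 (k + 2) 1)
      rw [hS2, inner_sub_left, lp.inner_single_left, lp.inner_single_left, ih k (by omega)] at h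
      simpa using h

end SequenceSpace

/-- For `0 < a ≤ √2`, the Jacobi operator `J_a` is unitarily equivalent to the free Jacobi
matrix `J_1`, i.e. to the adjacency operator of the infinite ray. -/
theorem stmt_17 (a : ℝ) (ha : 0 < a) (ha' : a ≤ Real.sqrt 2)
    (J : lp (fun _ : ℕ => ℂ) 2 →L[ℂ] lp (fun _ : ℕ => ℂ) 2)
    (hJ0 : ∀ ξ : lp (fun _ : ℕ => ℂ) 2, J ξ 0 = (a : ℂ) * ξ 1)
    (hJ1 : ∀ ξ : lp (fun _ : ℕ => ℂ) 2, J ξ 1 = (a : ℂ) * ξ 0 + ξ 2)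
    (hJn : ∀ (ξ : lp (fun _ : ℕ => ℂ) 2) (n : ℕ), 2 ≤ n → J ξ n = ξ (n - 1) + ξ (n + 1))
    (AR : lp (fun _ : ℕ => ℂ) 2 →L[ℂ] lp (fun _ : ℕ => ℂ) 2)
    (hAR : ∀ (ξ : lp (fun _ : ℕ => ℂ) 2) (n : ℕ),
      AR ξ n = (if n = 0 then 0 else ξ (n - 1)) + ξ (n + 1)) :
    ∃ U : lp (fun _ : ℕ => ℂ) 2 ≃ₗᵢ[ℂ] lp (fun _ : ℕ => ℂ) 2,
      ∀ ξ, U (J ξ) = AR (U ξ) := by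
  have hJ : IsSelfAdjoint J := isSelfAdjoint_of_single fun m n => by
    match m, n with
    | 0, 0 => simp [hJ0]
    | 0, 1 => simp [hJ0, hJ1]
    | 1, 0 => simp [hJ0, hJ1]
    | 1, 1 => simp [hJ1]
    | 0, n + 2 => simp [hJ0, hJn]
    | m + 2, 0 => simp [hJ0, hJn]
    | 1, n + 2 => simp [hJ1, hJn, Pi.single_apply, eq_comm]
    | m + 2, 1 => simp [hJ1, hJn, Pi.single_apply, eq_comm]
    | m + 2, n + 2 =>
      simp only [hJn _ _ (Nat.le_add_left 2 _), lp.single_apply, Pi.single_apply]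
      split_ifs <;> first | omega | simp
  have hA : IsSelfAdjoint AR := isSelfAdjoint_of_single fun m n => by
    simp only [hAR, lp.single_apply, Pi.single_apply]
    split_ifs <;> first | omega | simp
  refine exists_unitary_intertwining (S := jacobiIntertwiner a) hJ hA ?_
    (jacobiIntertwiner_injective ha ha') (denseRange_jacobiIntertwiner ha.ne')
  ext ξ n
  change jacobiIntertwiner a (J ξ) n = AR (jacobiIntertwiner a ξ) n
  match n with
  | 0 =>
    simp [jacobiIntertwiner_apply_zero, jacobiIntertwiner_apply_succ, hAR, hJ0, hJn]
    ring
  | 1 =>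
    simp [jacobiIntertwiner_apply_zero, jacobiIntertwiner_apply_succ, hAR, hJ1, hJn]
    ring
  | n + 2 =>
    simp [jacobiIntertwiner_apply_succ, hAR, hJn]
    ring
end
end

section
/- For every integer d ≥ 2, the adjacency operator of the rooted regular tree T_d^root of branching degree d has operator norm equal to 2·√d, and its spectrum is the closed interval [−2·√d, 2·√d]. -/
noncomputable section

open Filter Topology ContinuousLinearMap in
/-- If `V` is an isometry and `e` is a unit vector orthogonal to its range, every `t ∈ (-2, 2)`
lies in the spectrum of `V + V†`. -/
theorem mem_spectrum_isometry_add_adjoint {H : Type*} [NormedAddCommGroup H]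
    [InnerProductSpace ℂ H] [CompleteSpace H] (V : H →L[ℂ] H) (hV : adjoint V * V = 1)
    (e : H) (he : ‖e‖ = 1) (hVe : adjoint V e = 0) (t : ℝ) (ht : t ∈ Set.Ioo (-2 : ℝ) 2) :
    (t : ℂ) ∈ spectrum ℂ (V + adjoint V) := by
  have hVV : ∀ x, adjoint V (V x) = x := fun x => congrArg (fun W : H →L[ℂ] H => W x) hV
  have hmul : ∀ (S T : H →L[ℂ] H) (x : H), (S * T) x = S (T x) := fun _ _ _ => rfl
  have hinner : ∀ x y, inner ℂ (V x) (V y) = inner ℂ x y := fun x y => by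
    rw [← adjoint_inner_right, hVV]
  have horth : ∀ (k : ℕ) (x : H), inner ℂ e ((V ^ (k + 1)) x) = 0 := fun k x => by
    rw [pow_succ', hmul, ← adjoint_inner_left, hVe, inner_zero_left]
  have hpow : ∀ (k : ℕ) (x y : H), inner ℂ ((V ^ k) x) ((V ^ k) y) = inner ℂ x y := by
    intro k
    induction k with
    | zero => simp
    | succ k ih => intro x y; rw [pow_succ', hmul, hmul, hinner, ih]
  have hlt : ∀ j k : ℕ, j < k → inner ℂ ((V ^ j) e) ((V ^ k) e) = 0 := by
    intro j k hjk
    obtain ⟨m, rfl⟩ := Nat.exists_eq_add_of_lt hjk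
    rw [add_assoc, pow_add, hmul, hpow, horth]
  have hon : Orthonormal ℂ (fun k : ℕ => (V ^ k) e) := by
    constructor
    · intro k
      have h := hpow k e e
      rw [inner_self_eq_norm_sq_to_K, inner_self_eq_norm_sq_to_K, he] at h
      have h' : ‖(V ^ k) e‖ ^ 2 = 1 := by
        simpa using (by exact_mod_cast h : ‖(V ^ k) e‖ ^ 2 = 1 ^ 2)
      exact (pow_eq_one_iff_of_nonneg (norm_nonneg _) two_ne_zero).1 h'
    · intro j k hjk
      rcases lt_or_gt_of_ne hjk with h | h
      · exact hlt j k h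
      · exact inner_eq_zero_symm.1 (hlt k j h)
  by_contra hmem
  rw [spectrum.notMem_iff] at hmem
  obtain ⟨U, hU⟩ := hmem
  obtain ⟨ξ, hξ⟩ : ∃ ξ, V ξ + adjoint V ξ - (t : ℂ) • ξ = e := by
    refine ⟨-((U⁻¹ : (H →L[ℂ] H)ˣ) : H →L[ℂ] H) e, ?_⟩
    have h := congrArg (fun W : H →L[ℂ] H => W e) U.mul_inv
    simp only [hU, hmul, sub_apply, add_apply, one_apply_eq_self,
      Algebra.algebraMap_eq_smul_one, smul_apply] at h
    rw [map_neg, map_neg, smul_neg]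
    refine Eq.trans ?_ h
    abel
  set x : ℕ → ℝ := fun k => (inner ℂ ((V ^ k) e) ξ).re with hx
  have hstart : x 1 - t * x 0 = 1 := by
    have h := congrArg (fun y => (inner ℂ e y).re) hξ
    simp only [inner_sub_right, inner_add_right, inner_smul_right, adjoint_inner_right] at h
    rw [← adjoint_inner_left, hVe, inner_zero_left, inner_self_eq_norm_sq_to_K, he] at h
    simpa [hx] using h
  have hrec : ∀ k, x k + x (k + 2) - t * x (k + 1) = 0 := by
    intro k
    have h := congrArg (fun y => (inner ℂ ((V ^ (k + 1)) e) y).re) hξ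
    simp only [inner_sub_right, inner_add_right, inner_smul_right, adjoint_inner_right] at h
    rw [inner_eq_zero_symm.1 (horth k e), ← hmul, ← pow_succ', pow_succ' V k, hmul,
      hinner, ← hmul V, ← pow_succ'] at h
    simpa [hx] using h
  have hx0 : Tendsto x atTop (𝓝 0) := by
    have h := (hon.inner_products_summable ξ).tendsto_atTop_zero
    have h' := h.sqrt
    simp only [Real.sqrt_sq (norm_nonneg _), Real.sqrt_zero] at h'
    exact squeeze_zero_norm (fun k => Complex.abs_re_le_norm _) h'
  have hconst : ∀ k, x k ^ 2 + x (k + 1) ^ 2 - t * x k * x (k + 1)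
      = x 0 ^ 2 + x 1 ^ 2 - t * x 0 * x 1 := by
    intro k
    induction k with
    | zero => rfl
    | succ k ih => rw [← ih]; linear_combination (x (k + 2) - x k) * hrec k
  have hx1 := hx0.comp (tendsto_add_atTop_nat 1)
  have hlim := ((hx0.pow 2).add (hx1.pow 2)).sub ((hx0.const_mul t).mul hx1)
  simp only [Function.comp_def, hconst] at hlim
  have hQ := tendsto_nhds_unique tendsto_const_nhds hlim
  have hdisc : 0 < 4 - t ^ 2 := by nlinarith [ht.1, ht.2]
  have hx1' : x 1 = 1 + t * x 0 := by linarith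
  rw [hx1'] at hQ
  nlinarith [sq_nonneg (2 * x 0 + t)]

open ContinuousLinearMap in
/-- The sum of a non-unitary isometry and its adjoint has norm `2` and spectrum `[-2, 2]`. -/
theorem norm_and_spectrum_isometry_add_adjoint {H : Type*} [NormedAddCommGroup H]
    [InnerProductSpace ℂ H] [CompleteSpace H] (V : H →L[ℂ] H) (hV : adjoint V * V = 1)
    (e : H) (he : ‖e‖ = 1) (hVe : adjoint V e = 0) :
    ‖V + adjoint V‖ = 2 ∧
      spectrum ℂ (V + adjoint V) = Complex.ofReal '' Set.Icc (-2 : ℝ) 2 := by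
  have : Nontrivial H := ⟨e, 0, fun h => by simp [h] at he⟩
  have hV1 : ‖V‖ = 1 := by
    have h := norm_adjoint_comp_self V
    rw [← mul_def, hV, norm_one] at h
    nlinarith [norm_nonneg V]
  have hle : ‖V + adjoint V‖ ≤ 2 := by
    refine (norm_add_le _ _).trans ?_
    rw [LinearIsometryEquiv.norm_map, hV1]
    norm_num
  have hsub : Complex.ofReal '' Set.Icc (-2 : ℝ) 2 ⊆ spectrum ℂ (V + adjoint V) := by
    have hclosed : IsClosed (Complex.ofReal ⁻¹' spectrum ℂ (V + adjoint V)) :=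
      (spectrum.isClosed _).preimage Complex.continuous_ofReal
    rw [Set.image_subset_iff, ← closure_Ioo (by norm_num : (-2 : ℝ) ≠ 2)]
    exact hclosed.closure_subset_iff.2
      fun t ht => mem_spectrum_isometry_add_adjoint V hV e he hVe t ht
  have hsa : IsSelfAdjoint (V + adjoint V) := by
    simpa [star_eq_adjoint] using IsSelfAdjoint.add_star_self V
  refine ⟨le_antisymm hle ?_, Set.Subset.antisymm ?_ hsub⟩
  · have h := spectrum.norm_le_norm_of_mem (hsub ⟨2, by norm_num, rfl⟩)
    simpa using h
  · intro z hz
    refine ⟨z.re, abs_le.1 ?_, (hsa.mem_spectrum_eq_re hz).symm⟩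
    exact (Complex.abs_re_le_norm z).trans ((spectrum.norm_le_norm_of_mem hz).trans hle)

open scoped Pointwise in
theorem spectrum_smul_image {B : Type*} [Ring B] [Algebra ℂ B] (b : B) {r : ℂ} (hr : r ≠ 0) :
    spectrum ℂ (r • b) = (fun z => r * z) '' spectrum ℂ b :=
  spectrum.unit_smul_eq_smul b (Units.mk0 r hr)

/-- Composition with an injective map, as a bounded operator on `ℓ²`. -/
def lpCompInjective {α β : Type*} (f : α → β) (hf : Function.Injective f) :
    lp (fun _ : β => ℂ) 2 →L[ℂ] lp (fun _ : α => ℂ) 2 :=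
  LinearMap.mkContinuous
    { toFun := fun ξ => ⟨fun a => ξ (f a), by
        have h := lp.memℓp ξ
        rw [memℓp_gen_iff (by norm_num)] at h
        exact (memℓp_gen_iff (by norm_num)).2 (h.comp_injective hf)⟩
      map_add' := fun _ _ => rfl
      map_smul' := fun _ _ => rfl } 1 <| fun ξ => by
    rw [one_mul]
    refine lp.norm_le_of_tsum_le (by norm_num) (norm_nonneg _) ?_
    rw [lp.norm_rpow_eq_tsum (by norm_num)]
    have h := (memℓp_gen_iff (by norm_num)).1 (lp.memℓp ξ)
    exact tsum_comp_le_tsum_of_inj h (fun _ => by positivity) hf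

/-- The operator on `ℓ²` of the rooted tree which sums a function over the children. -/
def sumChildren (d : ℕ) :
    lp (fun _ : List (Fin d) => ℂ) 2 →L[ℂ] lp (fun _ : List (Fin d) => ℂ) 2 :=
  ∑ a : Fin d, lpCompInjective (List.cons a) List.cons_injective

theorem sumChildren_apply (d : ℕ) (ξ : lp (fun _ : List (Fin d) => ℂ) 2) (v : List (Fin d)) :
    sumChildren d ξ v = ∑ a : Fin d, ξ (a :: v) := by
  rw [sumChildren, sum_apply, lp.coeFn_sum, Finset.sum_apply]
  rfl

theorem sumChildren_single_nil (d : ℕ) : sumChildren d (lp.single 2 [] 1) = 0 := by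
  ext v
  simp [sumChildren_apply, lp.single_apply]

theorem sumChildren_single_cons (d : ℕ) (a : Fin d) (v : List (Fin d)) :
    sumChildren d (lp.single 2 (a :: v) 1) = lp.single 2 v 1 := by
  ext w
  by_cases h : w = v <;> simp [sumChildren_apply, lp.single_apply, Pi.single_apply, h]

theorem adjoint_sumChildren_apply (d : ℕ) (ξ : lp (fun _ : List (Fin d) => ℂ) 2)
    (v : List (Fin d)) :
    ContinuousLinearMap.adjoint (sumChildren d) ξ v = if v = [] then 0 else ξ v.tail := by
  have key : ∀ (η : lp (fun _ : List (Fin d) => ℂ) 2) (w : List (Fin d)),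
      inner ℂ (lp.single 2 w 1) η = η w := fun η w => by
    rw [lp.inner_single_left]
    simp
  rw [← key, ContinuousLinearMap.adjoint_inner_right]
  cases v with
  | nil => simp [sumChildren_single_nil]
  | cons a v => simp [sumChildren_single_cons, key]

/-- The adjacency operator of the rooted regular tree of branching degree `d ≥ 2` (vertices:
finite words over a `d`-letter alphabet; each vertex `v` is adjacent to its parent `v.tail`,
if `v` is not the root, and to its `d` children `a :: v`) has norm `2√d` and spectrum
`[-2√d, 2√d]`. -/
theorem stmt_18 (d : ℕ) (hd : 2 ≤ d)
    (A : lp (fun _ : List (Fin d) => ℂ) 2 →L[ℂ] lp (fun _ : List (Fin d) => ℂ) 2)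
    (hA : ∀ (ξ : lp (fun _ : List (Fin d) => ℂ) 2) (v : List (Fin d)),
      A ξ v = (if v = [] then 0 else ξ v.tail) + ∑ a : Fin d, ξ (a :: v)) :
    ‖A‖ = 2 * Real.sqrt d ∧
      spectrum ℂ A =
        Complex.ofReal '' Set.Icc (-(2 * Real.sqrt d)) (2 * Real.sqrt d) := by
  have hr : 0 < Real.sqrt d := Real.sqrt_pos.2 (by exact_mod_cast (by omega : 0 < d))
  have hr2 : ((Real.sqrt d : ℝ) : ℂ) * (Real.sqrt d : ℝ) = d := by
    exact_mod_cast Real.mul_self_sqrt (Nat.cast_nonneg d)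
  set r : ℝ := Real.sqrt d
  have hrc : (r : ℂ) ≠ 0 := by exact_mod_cast hr.ne'
  set V := (r : ℂ)⁻¹ • ContinuousLinearMap.adjoint (sumChildren d) with hVdef
  have hVadj : ContinuousLinearMap.adjoint V = (r : ℂ)⁻¹ • sumChildren d := by
    rw [hVdef, map_smulₛₗ, ContinuousLinearMap.adjoint_adjoint]
    simp
  have hV : ContinuousLinearMap.adjoint V * V = 1 := by
    ext ξ v
    rw [hVadj, hVdef]
    simp [sumChildren_apply, adjoint_sumChildren_apply, ← hr2]
    field_simp
  have hAV : A = (r : ℂ) • (V + ContinuousLinearMap.adjoint V) := by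
    rw [hVadj, hVdef, ← smul_add, smul_inv_smul₀ hrc]
    ext ξ v
    simp [hA, sumChildren_apply, adjoint_sumChildren_apply]
  have hnorm : ‖(lp.single 2 [] 1 : lp (fun _ : List (Fin d) => ℂ) 2)‖ = 1 := by
    rw [lp.norm_single (by norm_num)]
    simp
  obtain ⟨h1, h2⟩ := norm_and_spectrum_isometry_add_adjoint V hV (lp.single 2 [] 1) hnorm
    (by simp [hVadj, sumChildren_single_nil])
  refine ⟨?_, ?_⟩
  · rw [hAV, norm_smul, h1, Complex.norm_real, Real.norm_of_nonneg hr.le, mul_comm]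
  · rw [hAV, spectrum_smul_image _ hrc, h2]
    ext z
    simp only [Set.mem_image, Set.mem_Icc]
    constructor
    · rintro ⟨_, ⟨x, hx, rfl⟩, rfl⟩
      exact ⟨r * x, ⟨by nlinarith, by nlinarith⟩, by simp⟩
    · rintro ⟨x, hx, rfl⟩
      refine ⟨_, ⟨x / r, ⟨?_, ?_⟩, rfl⟩, ?_⟩
      · rw [le_div_iff₀ hr]; linarith
      · rw [div_le_iff₀ hr]; linarith
      · rw [Complex.ofReal_div, mul_div_cancel₀ _ hrc]
end
end
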